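/- For every minimal prime ideal 𝔮 of the ring R[1/p], there exists a prime ideal 𝔓 of R[1/p] with 𝔮 ⊆ 𝔓 and such that 𝔓 contains the image in R[1/p] of every one of the n²·d variables comprising the matrices X_3, …, X_{d+2}. (Equivalently: every irreducible component of Spec R[1/p] meets the closed subset cut out by X_3 = ⋯ = X_{d+2} = 0.) -/

import Mathlib

set_option synthInstance.maxHeartbeats 1000000
set_option maxHeartbeats 1000000

noncomputable section

/-- The ring of integers of `L`: the integral closure of `ℤ_[p]` in `L`. -/
abbrev RingOfIntegers (p : ℕ) [Fact p.Prime] (L : Type*) [Field L] [Algebra ℤ_[p] L] :=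
  integralClosure ℤ_[p] L

/-- The matrix of variables `X_k` inside the multivariate power series ring. -/
def varMatrix {A : Type*} [CommRing A] (N n : ℕ) (k : Fin N) :
    Matrix (Fin n) (Fin n) (MvPowerSeries (Fin N × Fin n × Fin n) A) :=
  Matrix.of fun i j => MvPowerSeries.X (k, i, j)

/-- `X̃_k = I + X_k`. -/
def Xt {A : Type*} [CommRing A] (N n : ℕ) (k : Fin N) :
    Matrix (Fin n) (Fin n) (MvPowerSeries (Fin N × Fin n × Fin n) A) :=
  1 + varMatrix N n k

/-- Commutator `[A, B] = A B A⁻¹ B⁻¹` of square matrices. -/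
def matComm {R : Type*} [CommRing R] {n : ℕ} (A B : Matrix (Fin n) (Fin n) R) :
    Matrix (Fin n) (Fin n) R :=
  A * B * A⁻¹ * B⁻¹

/-- The Demuškin relation matrix
`X̃_1^q ⬝ [X̃_1, X̃_2] ⬝ [X̃_3, X̃_4] ⋯ [X̃_{d+1}, X̃_{d+2}]` with `d = 2m`. -/
def relMatrix {A : Type*} [CommRing A] (q m n : ℕ) :
    Matrix (Fin n) (Fin n) (MvPowerSeries (Fin (2 * m + 2) × Fin n × Fin n) A) :=
  (Xt (2 * m + 2) n ⟨0, by omega⟩) ^ q *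
    (List.ofFn (fun i : Fin (m + 1) =>
      matComm (Xt (2 * m + 2) n ⟨2 * i, by have := i.isLt; omega⟩)
        (Xt (2 * m + 2) n ⟨2 * i + 1, by have := i.isLt; omega⟩))).prod

/-- The ideal generated by the `n²` entries of the relation matrix minus the identity. -/
def relIdeal {A : Type*} [CommRing A] (q m n : ℕ) :
    Ideal (MvPowerSeries (Fin (2 * m + 2) × Fin n × Fin n) A) :=
  Ideal.span (Set.range fun ij : Fin n × Fin n =>
    (relMatrix (A := A) q m n - 1) ij.1 ij.2)

/-- The universal framed deformation ring `R = S / I_rel`. -/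
abbrev defRing {A : Type*} [CommRing A] (q m n : ℕ) :=
  MvPowerSeries (Fin (2 * m + 2) × Fin n × Fin n) A ⧸ relIdeal (A := A) q m n

/-- The scheme-theoretic generic fiber `R[1/p]` of the framed deformation space. -/
def genericFiberRing (p : ℕ) (A : Type*) [CommRing A] (q m n : ℕ) : Type _ :=
  Localization.Away (p : defRing (A := A) q m n)

instance (p : ℕ) (A : Type*) [CommRing A] (q m n : ℕ) :
    CommRing (genericFiberRing p A q m n) :=
  inferInstanceAs (CommRing (Localization _))

instance (p : ℕ) (A : Type*) [CommRing A] (q m n : ℕ) :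
    Algebra (defRing (A := A) q m n) (genericFiberRing p A q m n) :=
  inferInstanceAs (Algebra _ (Localization _))

section DepthTheory

variable {S : Type*} [CommRing S]

/-- `x` is a nonzerodivisor on `S ⧸ I`. -/
def RegularMod (I : Ideal S) (x : S) : Prop := ∀ a, x * a ∈ I → a ∈ I

/-- `P` is an associated prime of `S ⧸ I`. -/
def IsAssocMod (I P : Ideal S) : Prop := P.IsPrime ∧ ∃ a, ∀ x, x ∈ P ↔ x * a ∈ I

/-- The list `l` is a (weakly) regular sequence on `S ⧸ I`. -/
def RegSeq : Ideal S → List S → Prop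
  | _, [] => True
  | I, x :: l => RegularMod I x ∧ RegSeq (I ⊔ Ideal.span {x}) l

theorem regSeq_append {I : Ideal S} {l₁ l₂ : List S} :
    RegSeq I (l₁ ++ l₂) ↔ RegSeq I l₁ ∧ RegSeq (I ⊔ Ideal.ofList l₁) l₂ := by
  induction l₁ generalizing I with
  | nil => simp [RegSeq]
  | cons x l ih => simp [RegSeq, ih, and_assoc, sup_assoc]

theorem IsAssocMod.le {I P : Ideal S} (h : IsAssocMod I P) : I ≤ P := by
  obtain ⟨-, a, ha⟩ := h
  exact fun x hx => (ha x).2 (I.mul_mem_right _ hx)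

theorem IsAssocMod.notMem_of_regularMod {I P : Ideal S} (h : IsAssocMod I P) {x : S}
    (hx : RegularMod I x) : x ∉ P := by
  obtain ⟨hP, a, ha⟩ := h
  intro hxP
  have h1 : a ∈ I := hx a ((ha x).1 hxP)
  exact hP.ne_top ((Ideal.eq_top_iff_one _).2 ((ha 1).2 (by simpa using h1)))

theorem regularMod_swap {I : Ideal S} {z w : S} (hz : RegularMod I z)
    (hw : RegularMod (I ⊔ Ideal.span {z}) w) : RegularMod (I ⊔ Ideal.span {w}) z := by
  intro a ha
  obtain ⟨i, hi, y, hy, e⟩ := Submodule.mem_sup.1 ha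
  obtain ⟨b, rfl⟩ := Ideal.mem_span_singleton'.1 hy
  have hb : b ∈ I ⊔ Ideal.span {z} := by
    apply hw
    have : w * b = -i + z * a := by rw [← e]; ring
    rw [this]
    exact add_mem (Ideal.mem_sup_left (neg_mem hi))
      (Ideal.mem_sup_right (Ideal.mul_mem_right _ _ (Ideal.mem_span_singleton_self z)))
  obtain ⟨j, hj, y, hy', e'⟩ := Submodule.mem_sup.1 hb
  obtain ⟨c, rfl⟩ := Ideal.mem_span_singleton'.1 hy'
  have : a - c * w ∈ I := by
    apply hz
    have : z * (a - c * w) = i + j * w := by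
      rw [mul_sub, ← e, ← e']; ring
    rw [this]
    exact add_mem hi (I.mul_mem_right _ hj)
  have h2 : a = (a - c * w) + c * w := by ring
  rw [h2]
  exact add_mem (Ideal.mem_sup_left this)
    (Ideal.mem_sup_right (Ideal.mul_mem_left _ _ (Ideal.mem_span_singleton_self w)))

theorem isAssocMod_iff [IsNoetherianRing S] {I P : Ideal S} :
    IsAssocMod I P ↔ P ∈ associatedPrimes S (S ⧸ I) := by
  rw [AssociatedPrimes.mem_iff, isAssociatedPrime_iff, IsAssocMod]
  refine and_congr_right fun _ => ⟨?_, ?_⟩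
  · rintro ⟨a, ha⟩
    refine ⟨Ideal.Quotient.mk I a, ?_⟩
    ext x
    rw [ha, Submodule.mem_colon_singleton, Submodule.mem_bot, Algebra.smul_def,
      Ideal.Quotient.algebraMap_eq, ← map_mul, Ideal.Quotient.eq_zero_iff_mem]
  · rintro ⟨a, rfl⟩
    obtain ⟨a, rfl⟩ := Ideal.Quotient.mk_surjective a
    refine ⟨a, fun x => ?_⟩
    rw [Submodule.mem_colon_singleton, Submodule.mem_bot, Algebra.smul_def,
      Ideal.Quotient.algebraMap_eq, ← map_mul, Ideal.Quotient.eq_zero_iff_mem]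

theorem finite_isAssocMod [IsNoetherianRing S] (I : Ideal S) : {P | IsAssocMod I P}.Finite := by
  simp only [isAssocMod_iff]
  exact associatedPrimes.finite S (S ⧸ I)

theorem exists_isAssocMod [IsNoetherianRing S] {I : Ideal S} {a : S} (ha : a ∉ I) :
    ∃ P, IsAssocMod I P ∧ ∀ x, x * a ∈ I → x ∈ P := by
  obtain ⟨P, hP, h⟩ := exists_le_isAssociatedPrime_of_isNoetherianRing S
    (Ideal.Quotient.mk I a) (by rwa [Ne, Ideal.Quotient.eq_zero_iff_mem])
  refine ⟨P, isAssocMod_iff.2 hP, fun x hx => h ?_⟩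
  rwa [Submodule.mem_colon_singleton, Submodule.mem_bot, Algebra.smul_def,
      Ideal.Quotient.algebraMap_eq, ← map_mul, Ideal.Quotient.eq_zero_iff_mem]

theorem isAssocMod_of_mem_minimalPrimes [IsNoetherianRing S] {I P : Ideal S}
    (h : P ∈ I.minimalPrimes) : IsAssocMod I P := by
  rw [isAssocMod_iff]
  apply Module.associatedPrimes.minimalPrimes_annihilator_subset_associatedPrimes
  rwa [Ideal.annihilator_quotient]

open IsLocalRing

variable [IsLocalRing S]

/-- `S ⧸ I` admits a weakly regular sequence of length `k` in the maximal ideal. -/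
def DepthGE : ℕ → Ideal S → Prop
  | 0, _ => True
  | k + 1, I => ∃ x ∈ maximalIdeal S, RegularMod I x ∧ DepthGE k (I ⊔ Ideal.span {x})

theorem RegSeq.depthGE {I : Ideal S} {l : List S} (h : RegSeq I l)
    (hl : ∀ x ∈ l, x ∈ maximalIdeal S) : DepthGE l.length I := by
  induction l generalizing I with
  | nil => trivial
  | cons x l ih =>
    exact ⟨x, hl x (by simp), h.1, ih h.2 fun y hy => hl y (by simp [hy])⟩

theorem exists_regularMod [IsNoetherianRing S] (I₁ I₂ I₃ : Ideal S)
    (h₁ : ¬ IsAssocMod I₁ (maximalIdeal S)) (h₂ : ¬ IsAssocMod I₂ (maximalIdeal S))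
    (h₃ : ¬ IsAssocMod I₃ (maximalIdeal S)) :
    ∃ w ∈ maximalIdeal S, RegularMod I₁ w ∧ RegularMod I₂ w ∧ RegularMod I₃ w := by
  set s : Set (Ideal S) := {P | IsAssocMod I₁ P} ∪ {P | IsAssocMod I₂ P} ∪ {P | IsAssocMod I₃ P}
    with hs
  have hfin : s.Finite :=
    ((finite_isAssocMod I₁).union (finite_isAssocMod I₂)).union (finite_isAssocMod I₃)
  have hprime : ∀ P ∈ s, P.IsPrime := by
    rintro P ((h | h) | h) <;> exact h.1
  have key : ¬ ((maximalIdeal S : Set S) ⊆ ⋃ P ∈ s, (P : Set S)) := by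
    intro hsub
    obtain ⟨P, hP, hle⟩ := (Ideal.subset_union_prime_finite (f := fun P : Ideal S => P) hfin ⊤ ⊤
      (fun P hP _ _ => hprime P hP)).1 hsub
    have hPm : P = maximalIdeal S :=
      le_antisymm (le_maximalIdeal (hprime P hP).ne_top) hle
    subst hPm
    rcases hP with (h | h) | h
    exacts [h₁ h, h₂ h, h₃ h]
  obtain ⟨w, hw, hw'⟩ := Set.not_subset.1 key
  simp only [Set.mem_iUnion, not_exists] at hw'
  have reg : ∀ I : Ideal S, (∀ P, IsAssocMod I P → P ∈ s) → RegularMod I w := by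
    intro I hI a ha
    by_contra hna
    obtain ⟨P, hP, h⟩ := exists_isAssocMod hna
    exact hw' P (hI P hP) (h w ha)
  exact ⟨w, hw, reg _ fun P h => Or.inl (Or.inl h), reg _ fun P h => Or.inl (Or.inr h),
    reg _ fun P h => Or.inr h⟩

theorem not_isAssocMod_sup {I : Ideal S} {x₁ x₂ z : S} (h₁ : RegularMod I x₁)
    (hx₁ : x₁ ∈ maximalIdeal S)
    (hx₂ : x₂ ∈ maximalIdeal S) (h₂ : RegularMod (I ⊔ Ideal.span {x₁}) x₂)
    (h : RegularMod I z) :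
    ¬ IsAssocMod (I ⊔ Ideal.span {z}) (maximalIdeal S) := by
  rintro ⟨-, a, ha⟩
  have hna : a ∉ I ⊔ Ideal.span {z} := fun h' =>
    (maximalIdeal.isMaximal S).ne_top ((Ideal.eq_top_iff_one _).2 ((ha 1).2 (by simpa using h')))
  obtain ⟨i, hi, y, hy, e⟩ := Submodule.mem_sup.1 ((ha x₁).1 hx₁)
  obtain ⟨w, rfl⟩ := Ideal.mem_span_singleton'.1 hy
  have hw : w ∉ I ⊔ Ideal.span {x₁} := by
    intro hw
    obtain ⟨j, hj, y, hy', e'⟩ := Submodule.mem_sup.1 hw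
    obtain ⟨c, rfl⟩ := Ideal.mem_span_singleton'.1 hy'
    apply hna
    have : a - c * z ∈ I := by
      apply h₁
      have : x₁ * (a - c * z) = i + j * z := by rw [mul_sub, ← e, ← e']; ring
      rw [this]
      exact add_mem hi (I.mul_mem_right _ hj)
    have h2 : a = (a - c * z) + c * z := by ring
    rw [h2]
    exact add_mem (Ideal.mem_sup_left this)
      (Ideal.mem_sup_right (Ideal.mul_mem_left _ _ (Ideal.mem_span_singleton_self z)))
  apply hw
  apply h₂
  obtain ⟨j, hj, y, hy', e'⟩ := Submodule.mem_sup.1 ((ha x₂).1 hx₂)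
  obtain ⟨b, rfl⟩ := Ideal.mem_span_singleton'.1 hy'
  have : x₂ * w - x₁ * b ∈ I := by
    apply h
    have : z * (x₂ * w - x₁ * b) = x₁ * j - x₂ * i := by
      linear_combination x₂ * e - x₁ * e'
    rw [this]
    exact sub_mem (I.mul_mem_left _ hj) (I.mul_mem_left _ hi)
  have h2 : x₂ * w = (x₂ * w - x₁ * b) + x₁ * b := by ring
  rw [h2]
  exact add_mem (Ideal.mem_sup_left this)
    (Ideal.mem_sup_right (Ideal.mul_mem_right _ _ (Ideal.mem_span_singleton_self x₁)))

theorem not_isAssocMod_of_regularMod {I : Ideal S} {x : S} (h : RegularMod I x)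
    (hx : x ∈ maximalIdeal S) : ¬ IsAssocMod I (maximalIdeal S) :=
  fun h' => h'.notMem_of_regularMod h hx

theorem DepthGE.sup_span_singleton [IsNoetherianRing S] {k : ℕ} {I : Ideal S}
    (h : DepthGE (k + 1) I) {z : S} (hz : z ∈ maximalIdeal S) (hzI : RegularMod I z) :
    DepthGE k (I ⊔ Ideal.span {z}) := by
  induction k generalizing I z with
  | zero => trivial
  | succ k ih =>
    obtain ⟨x₁, hx₁, h₁, h⟩ := h
    obtain ⟨x₂, hx₂, h₂, -⟩ := id h
    obtain ⟨w, hw, hwI, hwz, hwx⟩ := exists_regularMod I (I ⊔ Ideal.span {z})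
      (I ⊔ Ideal.span {x₁}) (not_isAssocMod_of_regularMod hzI hz)
      (not_isAssocMod_sup h₁ hx₁ hx₂ h₂ hzI) (not_isAssocMod_of_regularMod h₂ hx₂)
    have h3 : DepthGE k (I ⊔ Ideal.span {x₁} ⊔ Ideal.span {w}) := ih h hw hwx
    have h4 : DepthGE (k + 1) (I ⊔ Ideal.span {w}) :=
      ⟨x₁, hx₁, regularMod_swap h₁ hwx, by rwa [sup_right_comm] at h3⟩
    have h5 := ih h4 hz (regularMod_swap hzI hwz)
    exact ⟨w, hw, hwz, by rwa [sup_right_comm] at h5⟩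

theorem IsAssocMod.exists_sup [IsNoetherianRing S] {I P : Ideal S} (hP : IsAssocMod I P) {x : S}
    (hx : x ∈ maximalIdeal S) (hxI : RegularMod I x) :
    ∃ P', IsAssocMod (I ⊔ Ideal.span {x}) P' ∧ P ≤ P' := by
  obtain ⟨hprime, a, ha⟩ := hP
  have hna : a ∉ I := fun h' =>
    hprime.ne_top ((Ideal.eq_top_iff_one _).2 ((ha 1).2 (by simpa using h')))
  have hpow : ∃ k, ¬ ∃ b, a - x ^ k * b ∈ I := by
    by_contra! hcon
    apply hna
    have h1 := Ideal.iInf_pow_smul_eq_bot_of_isLocalRing (M := S ⧸ I) (Ideal.span {x})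
      (fun h => (maximalIdeal.isMaximal S).ne_top (top_le_iff.1 (h ▸ (by
        rwa [Ideal.span_singleton_le_iff_mem]))))
    rw [← Ideal.Quotient.eq_zero_iff_mem, ← Submodule.mem_bot S, ← h1, Submodule.mem_iInf]
    intro k
    obtain ⟨b, hb⟩ := hcon k
    have : Ideal.Quotient.mk I a = x ^ k • Ideal.Quotient.mk I b := by
      rw [Algebra.smul_def, Ideal.Quotient.algebraMap_eq, ← map_mul]
      exact Ideal.Quotient.eq.2 hb
    rw [this]
    exact Submodule.smul_mem_smul (Ideal.pow_mem_pow (Ideal.mem_span_singleton_self x) k) trivial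
  classical
  obtain ⟨k, hk⟩ : ∃ k, Nat.find hpow = k + 1 := by
    refine Nat.exists_eq_succ_of_ne_zero fun h0 => ?_
    have := Nat.find_spec hpow
    rw [h0] at this
    exact this ⟨a, by simp⟩
  obtain ⟨b, hb⟩ : ∃ b, a - x ^ k * b ∈ I := by
    have := Nat.find_min hpow (m := k) (by omega)
    push Not at this
    exact this
  have hspec := Nat.find_spec hpow
  rw [hk] at hspec
  have hbn : b ∉ I ⊔ Ideal.span {x} := by
    intro hb'
    obtain ⟨i, hi, y, hy, e⟩ := Submodule.mem_sup.1 hb'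
    obtain ⟨c, rfl⟩ := Ideal.mem_span_singleton'.1 hy
    apply hspec
    refine ⟨c, ?_⟩
    have : a - x ^ (k + 1) * c = (a - x ^ k * b) + x ^ k * i := by rw [← e]; ring
    rw [this]
    exact add_mem hb (I.mul_mem_left _ hi)
  have hxk : ∀ (k : ℕ) c, x ^ k * c ∈ I → c ∈ I := by
    intro k
    induction k with
    | zero => simp
    | succ k ih => exact fun c hc => ih c (hxI _ (by rwa [← mul_assoc, ← pow_succ']))
  obtain ⟨P', hP', h⟩ := exists_isAssocMod hbn
  refine ⟨P', hP', fun y hy => h y (Ideal.mem_sup_left (hxk k _ ?_))⟩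
  have : x ^ k * (y * b) = y * a - y * (a - x ^ k * b) := by ring
  rw [this]
  exact sub_mem ((ha y).1 hy) (I.mul_mem_left _ hb)

theorem IsAssocMod.exists_sup_ofList [IsNoetherianRing S] {I P : Ideal S} (hP : IsAssocMod I P)
    {l : List S} (hl : ∀ x ∈ l, x ∈ maximalIdeal S) (h : RegSeq I l) :
    ∃ P', IsAssocMod (I ⊔ Ideal.ofList l) P' ∧ P ≤ P' := by
  induction l generalizing I P with
  | nil => exact ⟨P, by simpa using hP, le_rfl⟩
  | cons x l ih =>
    obtain ⟨P₁, h₁, hle⟩ := hP.exists_sup (hl x (by simp)) h.1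
    obtain ⟨P₂, h₂, hle'⟩ := ih h₁ (fun y hy => hl y (by simp [hy])) h.2
    exact ⟨P₂, by rwa [Ideal.ofList_cons, ← sup_assoc], hle.trans hle'⟩

theorem DepthGE.le_ringKrullDim [IsNoetherianRing S] {k : ℕ} {I P : Ideal S} (h : DepthGE k I)
    (hP : IsAssocMod I P) : (k : WithBot ℕ∞) ≤ ringKrullDim (S ⧸ P) := by
  induction k generalizing I P with
  | zero =>
    have := Ideal.Quotient.nontrivial_iff.2 hP.1.ne_top
    simpa using ringKrullDim_nonneg_of_nontrivial
  | succ k ih =>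
    obtain ⟨x, hx, hxI, h⟩ := h
    obtain ⟨P', hP', hle⟩ := hP.exists_sup hx hxI
    have hPp := hP.1
    have h1 := ih h hP'
    have hxP : x ∉ P := hP.notMem_of_regularMod hxI
    have hxP' : x ∈ P' := hP'.le (Ideal.mem_sup_right (Ideal.mem_span_singleton_self x))
    have h2 := ringKrullDim_quotient_succ_le_of_nonZeroDivisor (R := S ⧸ P)
      (r := Ideal.Quotient.mk P x) (mem_nonZeroDivisors_of_ne_zero (by
        rwa [Ne, Ideal.Quotient.eq_zero_iff_mem]))
    have h3 : ringKrullDim (S ⧸ P') ≤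
        ringKrullDim ((S ⧸ P) ⧸ Ideal.span {Ideal.Quotient.mk P x}) := by
      refine ringKrullDim_le_of_surjective (Ideal.Quotient.lift _ (Ideal.Quotient.factor hle) ?_) ?_
      · intro a ha
        have : Ideal.span {Ideal.Quotient.mk P x} ≤ RingHom.ker (Ideal.Quotient.factor hle) := by
          rw [Ideal.span_singleton_le_iff_mem, RingHom.mem_ker, Ideal.Quotient.factor_mk,
            Ideal.Quotient.eq_zero_iff_mem]
          exact hxP'
        exact this ha
      · exact Ideal.Quotient.lift_surjective_of_surjective _ _
          (Ideal.Quotient.factor_surjective hle)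
    push_cast
    calc (k : WithBot ℕ∞) + 1 ≤ ringKrullDim (S ⧸ P') + 1 := by gcongr
      _ ≤ _ := by gcongr
      _ ≤ _ := h2

theorem ringKrullDim_quotient_le_sup_span_singleton [IsNoetherianRing S] {I : Ideal S} {x : S}
    (hI : I ≤ maximalIdeal S) (hx : x ∈ maximalIdeal S) :
    ringKrullDim (S ⧸ I) ≤ ringKrullDim (S ⧸ (I ⊔ Ideal.span {x})) + 1 := by
  have := Ideal.Quotient.nontrivial_iff.2 (ne_top_of_le_ne_top Ideal.IsPrime.ne_top' hI)
  have := IsLocalRing.of_surjective' (Ideal.Quotient.mk I) Ideal.Quotient.mk_surjective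
  have h := ringKrullDim_le_ringKrullDim_quotient_add_encard (R := S ⧸ I)
    {Ideal.Quotient.mk I x} (by
      rw [IsLocalRing.ringJacobson_eq_maximalIdeal, Set.singleton_subset_iff, SetLike.mem_coe,
        mem_maximalIdeal, mem_nonunits_iff]
      intro hu
      obtain ⟨u, hu⟩ := hu.exists_right_inv
      obtain ⟨u, rfl⟩ := Ideal.Quotient.mk_surjective u
      rw [← map_mul, ← map_one (Ideal.Quotient.mk I), Ideal.Quotient.eq] at hu
      refine (maximalIdeal.isMaximal S).ne_top ((Ideal.eq_top_iff_one _).2 ?_)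
      have : (1 : S) = x * u - (x * u - 1) := by ring
      rw [this]
      exact sub_mem (Ideal.mul_mem_right _ _ hx) (hI hu))
  have e : ringKrullDim ((S ⧸ I) ⧸ Ideal.span {Ideal.Quotient.mk I x}) =
      ringKrullDim (S ⧸ (I ⊔ Ideal.span {x})) := by
    rw [← Set.image_singleton, ← Ideal.map_span]
    exact ringKrullDim_eq_of_ringEquiv (DoubleQuot.quotQuotEquivQuotSup _ _)
  rw [e] at h
  simpa using h

theorem ofList_le_maximalIdeal {l : List S} (hl : ∀ x ∈ l, x ∈ maximalIdeal S) :
    Ideal.ofList l ≤ maximalIdeal S := Ideal.span_le.2 hl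

theorem ringKrullDim_quotient_le_sup_ofList [IsNoetherianRing S] {I : Ideal S} {l : List S}
    (hI : I ≤ maximalIdeal S) (hl : ∀ x ∈ l, x ∈ maximalIdeal S) :
    ringKrullDim (S ⧸ I) ≤ ringKrullDim (S ⧸ (I ⊔ Ideal.ofList l)) + (l.length : ℕ) := by
  induction l generalizing I with
  | nil =>
    have h : I ⊔ Ideal.ofList [] = I := by simp
    rw [h]
    simp
  | cons x l ih =>
    have hx : x ∈ maximalIdeal S := hl x (by simp)
    have h1 := ringKrullDim_quotient_le_sup_span_singleton hI hx
    have h2 := ih (I := I ⊔ Ideal.span {x}) (sup_le hI (by rwa [Ideal.span_singleton_le_iff_mem]))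
      (fun y hy => hl y (by simp [hy]))
    rw [Ideal.ofList_cons, ← sup_assoc]
    refine (h1.trans (add_le_add_left h2 1)).trans_eq ?_
    rw [List.length_cons, Nat.cast_add, Nat.cast_one, add_assoc]

/-- In a local ring of large depth, a sequence cutting out a quotient of the expected dimension
is regular. -/
theorem DepthGE.regSeq [IsNoetherianRing S] {N c : ℕ} {I : Ideal S} {l : List S}
    (h : DepthGE N I) (hI : I ≤ maximalIdeal S) (hl : ∀ x ∈ l, x ∈ maximalIdeal S)
    (hc : ringKrullDim (S ⧸ (I ⊔ Ideal.ofList l)) ≤ (c : ℕ)) (hN : c + l.length ≤ N) :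
    RegSeq I l := by
  induction l generalizing I N with
  | nil => trivial
  | cons x l ih =>
    have hx : x ∈ maximalIdeal S := hl x (by simp)
    have hl' : ∀ y ∈ l, y ∈ maximalIdeal S := fun y hy => hl y (by simp [hy])
    have hIx : I ⊔ Ideal.span {x} ≤ maximalIdeal S :=
      sup_le hI (by rwa [Ideal.span_singleton_le_iff_mem])
    rw [Ideal.ofList_cons, ← sup_assoc] at hc
    have hreg : RegularMod I x := by
      intro a ha
      by_contra hna
      obtain ⟨P, hP, hxP⟩ := exists_isAssocMod hna
      have h1 := h.le_ringKrullDim hP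
      have h2 : ringKrullDim (S ⧸ P) ≤ ringKrullDim (S ⧸ (I ⊔ Ideal.span {x})) :=
        ringKrullDim_le_of_surjective
          (Ideal.Quotient.factor (sup_le hP.le (by
            rw [Ideal.span_singleton_le_iff_mem]; exact hxP x ha)))
          (Ideal.Quotient.factor_surjective _)
      have h3 := ringKrullDim_quotient_le_sup_ofList hIx hl'
      have h4 : (N : WithBot ℕ∞) ≤ (c : ℕ) + (l.length : ℕ) :=
        h1.trans (h2.trans (h3.trans (by gcongr)))
      have h5 : N ≤ c + l.length := by exact_mod_cast h4
      rw [List.length_cons] at hN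
      omega
    refine ⟨hreg, ?_⟩
    rw [List.length_cons] at hN
    obtain ⟨N, rfl⟩ : ∃ k, N = k + 1 := ⟨N - 1, by omega⟩
    exact ih (h.sup_span_singleton hx hreg) hIx hl' hc (by omega)

theorem exists_prime_of_regSeq [IsNoetherianRing S] {I Q : Ideal S} {l : List S} {x : S}
    (hQ : Q ∈ I.minimalPrimes) (hl : ∀ y ∈ l, y ∈ maximalIdeal S) (h : RegSeq I (l ++ [x])) :
    ∃ P : Ideal S, P.IsPrime ∧ Q ≤ P ∧ (∀ y ∈ l, y ∈ P) ∧ x ∉ P := by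
  rw [regSeq_append] at h
  obtain ⟨P, hP, hle⟩ := (isAssocMod_of_mem_minimalPrimes hQ).exists_sup_ofList hl h.1
  refine ⟨P, hP.1, hle, fun y hy => hP.le (Ideal.mem_sup_right (Ideal.subset_span hy)),
    hP.notMem_of_regularMod h.2.1⟩

end DepthTheory

section PowerSeriesVariables

open MvPowerSeries

variable {σ A : Type*} [CommRing A]

theorem MvPowerSeries.mem_span_X_iff (l : List σ) (f : MvPowerSeries σ A) :
    f ∈ Ideal.ofList (l.map (X : σ → MvPowerSeries σ A)) ↔
      ∀ d : σ →₀ ℕ, (∀ i ∈ l, d i = 0) → coeff d f = 0 := by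
  classical
  induction l generalizing f with
  | nil =>
    simp [MvPowerSeries.ext_iff]
  | cons i l ih =>
    rw [List.map_cons, Ideal.ofList_cons]
    constructor
    · intro hf d hd
      obtain ⟨y, hy, z, hz, rfl⟩ := Submodule.mem_sup.1 hf
      rw [map_add, (ih z).1 hz d fun j hj => hd j (by simp [hj]), add_zero]
      exact X_dvd_iff.1 (Ideal.mem_span_singleton.1 hy) d (hd i (by simp))
    · intro h
      let f₀ : MvPowerSeries σ A := fun d => if d i = 0 then coeff d f else 0
      have hf₀ : ∀ d, coeff d f₀ = if d i = 0 then coeff d f else 0 := fun _ => rfl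
      have e : f = (f - f₀) + f₀ := by ring
      rw [e]
      refine add_mem (Ideal.mem_sup_left (Ideal.mem_span_singleton.2 (X_dvd_iff.2 ?_)))
        (Ideal.mem_sup_right ((ih f₀).2 ?_))
      · intro d hd
        rw [map_sub, hf₀, if_pos hd, sub_self]
      · intro d hd
        rw [hf₀]
        split_ifs with hi
        · exact h d (by simpa [hi] using hd)
        · rfl

theorem regularMod_X {l : List σ} {j : σ} (hj : j ∉ l) :
    RegularMod (Ideal.ofList (l.map (X : σ → MvPowerSeries σ A))) (X j) := by
  intro a ha
  rw [mem_span_X_iff] at ha ⊢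
  intro d hd
  have h := ha (Finsupp.single j 1 + d) fun i hi => by
    have : j ≠ i := fun h => hj (h ▸ hi)
    simp [hd i hi, Finsupp.single_eq_of_ne' this]
  rwa [X, coeff_add_monomial_mul, one_mul] at h

theorem regularMod_C [IsDomain A] {l : List σ} {c : A} (hc : c ≠ 0) :
    RegularMod (Ideal.ofList (l.map (X : σ → MvPowerSeries σ A))) (C c) := by
  intro a ha
  rw [mem_span_X_iff] at ha ⊢
  intro d hd
  have h := ha d hd
  rw [coeff_C_mul] at h
  exact (mul_eq_zero.1 h).resolve_left hc

theorem regSeq_map_X {l' l : List σ} (h : (l' ++ l).Nodup) :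
    RegSeq (Ideal.ofList (l'.map (X : σ → MvPowerSeries σ A))) (l.map X) := by
  induction l generalizing l' with
  | nil => trivial
  | cons j l ih =>
    refine ⟨regularMod_X fun hj => ?_, ?_⟩
    · exact (List.nodup_append.1 h).2.2 j hj j (by simp) rfl
    · have := ih (l' := l' ++ [j]) (by simpa using h)
      simpa [Ideal.ofList_append] using this

theorem regSeq_X_C [IsDomain A] [Fintype σ] {c : A} (hc : c ≠ 0) :
    RegSeq (⊥ : Ideal (MvPowerSeries σ A)) (Finset.univ.toList.map X ++ [C c]) := by
  rw [regSeq_append]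
  refine ⟨?_, ?_, trivial⟩
  · have h := regSeq_map_X (A := A) (l' := []) (l := (Finset.univ : Finset σ).toList)
      (by simpa using Finset.nodup_toList _)
    simpa using h
  · rw [bot_sup_eq]
    exact regularMod_C hc

end PowerSeriesVariables

section PadicIntegers

variable (p : ℕ) [Fact p.Prime] (L : Type*) [Field L] [Algebra ℤ_[p] L]

theorem isMaximal_of_natCast_mem (P : Ideal (integralClosure ℤ_[p] L)) [P.IsPrime]
    (h : (p : integralClosure ℤ_[p] L) ∈ P) : P.IsMaximal := by
  refine Ideal.isMaximal_of_isIntegral_of_isMaximal_comap (R := ℤ_[p]) P ?_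
  have h1 : IsLocalRing.maximalIdeal ℤ_[p] ≤ P.comap (algebraMap _ _) := by
    rw [PadicInt.maximalIdeal_eq_span_p, Ideal.span_singleton_le_iff_mem, Ideal.mem_comap]
    simpa using h
  rw [← (IsLocalRing.maximalIdeal.isMaximal ℤ_[p]).eq_of_le (Ideal.IsPrime.ne_top inferInstance) h1]
  exact IsLocalRing.maximalIdeal.isMaximal _

variable [Algebra ℚ_[p] L]

theorem padicInt_natCast_ne_zero : (p : integralClosure ℤ_[p] L) ≠ 0 := by
  intro h
  have h1 : (p : L) = 0 := by simpa using congrArg Subtype.val h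
  have : CharZero L := charZero_of_injective_algebraMap (algebraMap ℚ_[p] L).injective
  exact (Fact.out : p.Prime).ne_zero (by exact_mod_cast h1)

variable [IsScalarTower ℤ_[p] ℚ_[p] L]

theorem padicInt_natCast_not_isUnit : ¬ IsUnit (p : integralClosure ℤ_[p] L) := by
  intro h
  have h1 : IsUnit (p : ℤ_[p]) := by
    have : (p : integralClosure ℤ_[p] L) = algebraMap ℤ_[p] (integralClosure ℤ_[p] L) p := by simp
    rw [this] at h
    have hinj : Function.Injective (algebraMap ℤ_[p] (integralClosure ℤ_[p] L)) := by
      have : Function.Injective (algebraMap ℤ_[p] L) := by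
        rw [IsScalarTower.algebraMap_eq ℤ_[p] ℚ_[p] L]
        exact (algebraMap ℚ_[p] L).injective.comp (IsFractionRing.injective _ _)
      intro x y hxy
      exact this (congrArg Subtype.val hxy)
    have : IsLocalHom (algebraMap ℤ_[p] (integralClosure ℤ_[p] L)) :=
      (algebraMap_isIntegral_iff.2 inferInstance).isLocalHom hinj
    exact isUnit_of_map_unit _ _ h
  exact PadicInt.prime_p.not_isUnit h1

variable [FiniteDimensional ℚ_[p] L]

theorem isIntegral_padicInt_iff_spectralNorm_le_one (x : L) :
    IsIntegral ℤ_[p] x ↔ spectralNorm ℚ_[p] L x ≤ 1 := by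
  have hx : IsIntegral ℚ_[p] x := Algebra.IsIntegral.isIntegral x
  rw [spectralNorm, spectralValue_le_one_iff (minpoly.monic hx)]
  constructor
  · intro h k
    rw [minpoly.isIntegrallyClosed_eq_field_fractions' ℚ_[p] h, Polynomial.coeff_map]
    exact PadicInt.norm_le_one _
  · intro h
    obtain ⟨P, hP, -, hPm⟩ := (Polynomial.lifts_and_natDegree_eq_and_monic
      (f := algebraMap ℤ_[p] ℚ_[p]) (p := minpoly ℚ_[p] x)
      ((Polynomial.lifts_iff_coeff_lifts _).2 fun k => ⟨⟨_, h k⟩, rfl⟩) (minpoly.monic hx))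
    refine ⟨P, hPm, ?_⟩
    rw [← Polynomial.aeval_def, ← Polynomial.aeval_map_algebraMap ℚ_[p], hP, minpoly.aeval]

theorem isNoetherianRing_integralClosure_padicInt :
    IsNoetherianRing (integralClosure ℤ_[p] L) :=
  IsIntegralClosure.isNoetherianRing ℤ_[p] ℚ_[p] L _

theorem isLocalRing_integralClosure_padicInt : IsLocalRing (integralClosure ℤ_[p] L) := by
  have key : ∀ a : integralClosure ℤ_[p] L,
      IsUnit a ↔ ¬ spectralNorm ℚ_[p] L (a : L) < 1 := by
    intro a
    have hmul : ∀ x y : L, spectralNorm ℚ_[p] L (x * y) =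
      spectralNorm ℚ_[p] L x * spectralNorm ℚ_[p] L y := fun x y => spectralAlgNorm_mul x y
    have hle := (isIntegral_padicInt_iff_spectralNorm_le_one p L _).1 a.2
    constructor
    · rintro hu hlt
      obtain ⟨b, hb⟩ := hu.exists_right_inv
      have hb' := (isIntegral_padicInt_iff_spectralNorm_le_one p L _).1 b.2
      have h1 := hmul a b
      have : (a : L) * b = 1 := by exact_mod_cast congrArg Subtype.val hb
      rw [this, spectralNorm_one] at h1
      have := spectralNorm_nonneg (K := ℚ_[p]) (a : L)
      nlinarith
    · intro h
      have h1 : spectralNorm ℚ_[p] L (a : L) = 1 := le_antisymm hle (not_lt.1 h)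
      have h0 : (a : L) ≠ 0 := by
        intro h0
        rw [h0, spectralNorm_zero] at h1
        exact zero_ne_one h1
      have h2 := hmul a (a : L)⁻¹
      rw [mul_inv_cancel₀ h0, spectralNorm_one, h1, one_mul] at h2
      exact IsUnit.of_mul_eq_one ⟨(a : L)⁻¹,
        (isIntegral_padicInt_iff_spectralNorm_le_one p L _).2 h2.ge⟩
        (Subtype.ext (mul_inv_cancel₀ h0))
  refine IsLocalRing.of_nonunits_add fun a b ha hb => ?_
  rw [mem_nonunits_iff, key, not_not] at ha hb ⊢
  exact (isNonarchimedean_spectralNorm (a : L) b).trans_lt (max_lt ha hb)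

end PadicIntegers

section RationalForm

open Polynomial

variable {K : Type*} [Field K]

theorem exists_basis_quotient_repr_mem (F : Subfield K) {I : Ideal K[X]} {g : K[X]}
    (hg : g.Monic) (hI : I = Ideal.span {g}) (hgF : ∀ i, g.coeff i ∈ F) :
    ∃ (d : ℕ) (b : Module.Basis (Fin d) K (K[X] ⧸ I)),
      ∀ i j, b.repr ((X : K[X]) • b i) j ∈ F := by
  subst hI
  let pb : PowerBasis K (AdjoinRoot g) := AdjoinRoot.powerBasis hg.ne_zero
  refine ⟨pb.dim, pb.basis, fun i j => ?_⟩
  have h : Algebra.leftMulMatrix pb.basis pb.gen j i ∈ F := by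
    rw [pb.leftMulMatrix, Matrix.of_apply]
    have hmin : pb.minpolyGen = g := by
      rw [pb.minpolyGen_eq]
      exact AdjoinRoot.minpoly_powerBasis_gen_of_monic hg
    rw [hmin]
    split_ifs
    exacts [neg_mem (hgF _), one_mem _, zero_mem _]
  rw [Algebra.leftMulMatrix_eq_repr_mul] at h
  let y : K[X] ⧸ Ideal.span {g} := pb.basis i
  have e : (X : K[X]) • y = Ideal.Quotient.mk _ X * y := by
    obtain ⟨z, hz⟩ := Ideal.Quotient.mk_surjective y
    rw [← hz]
    rfl
  change pb.basis.repr ((X : K[X]) • y) j ∈ F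
  rw [e]
  exact h

theorem coeff_X_sub_C_pow_mem (F : Subfield K) {c : K} (hc : c ∈ F) (e i : ℕ) :
    ((X - C c) ^ e).coeff i ∈ F := by
  have : (X - C c) ^ e = ((X - C (⟨c, hc⟩ : F)) ^ e).map F.subtype := by
    simp [Polynomial.map_pow]
  rw [this, coeff_map]
  exact Subtype.property _

/-- An endomorphism all of whose eigenvalues lie in a subfield `F` is represented in some basis
by a matrix with entries in `F`. -/
theorem exists_basis_repr_mem [IsAlgClosed K] {V : Type*} [AddCommGroup V] [Module K V]
    [FiniteDimensional K V] (f : Module.End K V) (F : Subfield K)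
    (hF : ∀ c ∈ spectrum K f, c ∈ F) :
    ∃ b : Module.Basis (Fin (Module.finrank K V)) K V, ∀ i j, b.repr (f (b i)) j ∈ F := by
  classical
  obtain ⟨ι, hι, p, hp, e, ⟨E⟩⟩ := Module.equiv_directSum_of_isTorsion
    (Module.AEval.isTorsion_of_finiteDimensional K V f)
  have hfE : ∀ v, E (Module.AEval'.of f (f v)) = (X : K[X]) • E (Module.AEval'.of f v) := by
    intro v
    rw [← Module.AEval'.X_smul_of, map_smul]
  have hblock : ∀ i, ∃ (d : ℕ) (b : Module.Basis (Fin d) K (K[X] ⧸ Submodule.span K[X] {p i ^ e i})),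
      ∀ k j, b.repr ((X : K[X]) • b k) j ∈ F := by
    intro i
    obtain ⟨c, hc⟩ := exists_root_of_degree_eq_one (IsAlgClosed.degree_eq_one_of_irreducible K (hp i))
    have hassoc : Associated (X - C c) (p i) :=
      (prime_X_sub_C c).irreducible.associated_of_dvd (hp i) (dvd_iff_isRoot.2 hc)
    rcases Nat.eq_zero_or_pos (e i) with he | he
    · exact exists_basis_quotient_repr_mem F (g := 1) monic_one (by simp [he]) (fun k => by
        rw [coeff_one]; split_ifs; exacts [one_mem _, zero_mem _])
    · have hcF : c ∈ F := by
        apply hF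
        rw [← Module.End.hasEigenvalue_iff_mem_spectrum]
        let w : DirectSum ι fun i => K[X] ⧸ Submodule.span K[X] {p i ^ e i} :=
          DirectSum.lof K[X] ι _ i (Submodule.Quotient.mk (p i ^ (e i - 1)))
        have hw0 : w ≠ 0 := by
          intro h0
          have h1 : (Submodule.Quotient.mk (p i ^ (e i - 1)) :
              K[X] ⧸ Submodule.span K[X] {p i ^ e i}) = 0 :=
            (DirectSum.of_injective (β := fun i => K[X] ⧸ Submodule.span K[X] {p i ^ e i}) i)
              (h0.trans (map_zero (DirectSum.lof K[X] ι
                (fun i => K[X] ⧸ Submodule.span K[X] {p i ^ e i}) i)).symm)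
          rw [Submodule.Quotient.mk_eq_zero, Submodule.mem_span_singleton] at h1
          obtain ⟨a, ha⟩ := h1
          have : p i ^ e i ∣ p i ^ (e i - 1) := ⟨a, by rw [← ha, smul_eq_mul, mul_comm]⟩
          have := (pow_dvd_pow_iff (hp i).ne_zero (hp i).not_isUnit).1 this
          omega
        have hXw : (X : K[X]) • w = C c • w := by
          have h2 : ((X - C c) • (Submodule.Quotient.mk (p i ^ (e i - 1))) :
              K[X] ⧸ Submodule.span K[X] {p i ^ e i}) = 0 := by
            rw [← Submodule.Quotient.mk_smul, Submodule.Quotient.mk_eq_zero,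
              Submodule.mem_span_singleton]
            obtain ⟨u, hu⟩ := hassoc.symm
            refine ⟨u, ?_⟩
            rw [smul_eq_mul, smul_eq_mul, ← hu]
            obtain ⟨k, hk⟩ : ∃ k, e i = k + 1 := ⟨e i - 1, by omega⟩
            rw [hk, Nat.add_sub_cancel]
            ring
          rw [sub_smul, sub_eq_zero] at h2
          simp only [w]
          rw [← LinearMap.map_smul, ← LinearMap.map_smul, h2]
        obtain ⟨v, hv⟩ : ∃ v, E (Module.AEval'.of f v) = w :=
          ⟨(Module.AEval'.of f).symm (E.symm w), by simp⟩
        refine Module.End.hasEigenvalue_of_hasEigenvector (x := v)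
          ⟨Module.End.mem_eigenspace_iff.2 ?_, ?_⟩
        · apply (Module.AEval'.of f).injective
          apply E.injective
          rw [hfE, hv, hXw, ← hv, ← Polynomial.algebraMap_eq, algebraMap_smul, map_smul]
          exact ((E.restrictScalars K).map_smul c _).symm
        · rintro rfl
          exact hw0 (by rw [← hv, map_zero, map_zero])
      refine exists_basis_quotient_repr_mem F ((monic_X_sub_C c).pow (e i)) ?_
        (coeff_X_sub_C_pow_mem F hcF _)
      exact Ideal.span_singleton_eq_span_singleton.2 (hassoc.symm.pow_pow)
  choose d b hb using hblock
  let EK : V ≃ₗ[K] DirectSum ι fun i => K[X] ⧸ Submodule.span K[X] {p i ^ e i} :=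
    (Module.AEval'.of f).trans (E.restrictScalars K)
  let B := (DFinsupp.basis b).map EK.symm
  have hBF : ∀ i j, B.repr (f (B i)) j ∈ F := by
    rintro ⟨i, k⟩ ⟨i', k'⟩
    have h1 : EK (B ⟨i, k⟩) = DirectSum.lof K[X] ι
        (fun i => K[X] ⧸ Submodule.span K[X] {p i ^ e i}) i (b i k) := by
      simp only [B, Module.Basis.map_apply, LinearEquiv.apply_symm_apply]
      simp only [DFinsupp.basis, DirectSum.lof, Module.Basis.coe_ofRepr]
      simp
      rfl
    have h2 : EK (f (B ⟨i, k⟩)) = DirectSum.lof K[X] ι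
        (fun i => K[X] ⧸ Submodule.span K[X] {p i ^ e i}) i ((X : K[X]) • b i k) := by
      rw [LinearMap.map_smul, ← h1]
      exact hfE _
    have h3 : ∀ v, B.repr v ⟨i', k'⟩ = (b i').repr (EK v i') k' := by
      intro v
      rfl
    rw [h3, h2]
    rcases eq_or_ne i i' with rfl | hne
    · rw [DirectSum.lof_apply]
      exact hb _ _ _
    · have : (DirectSum.lof K[X] ι (fun i => K[X] ⧸ Submodule.span K[X] {p i ^ e i}) i
          ((X : K[X]) • b i k)) i' = 0 := DFinsupp.single_eq_of_ne (Ne.symm hne)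
      rw [this, map_zero]
      exact zero_mem _
  let r := B.indexEquiv (Module.finBasis K V)
  refine ⟨B.reindex r, fun i j => ?_⟩
  rw [B.reindex_apply, B.repr_reindex_apply]
  exact hBF _ _

end RationalForm

section Pivots

variable {K : Type*} [Field K] {m : Type*} [Fintype m]

/-- Every space of matrices has a set of entries serving as coordinates. -/
theorem exists_pivots (H : Submodule K (Matrix m m K)) :
    ∃ I : Finset (m × m), I.card = Module.finrank K H ∧
      (∀ t : m × m → K, ∃ y ∈ H, ∀ i ∈ I, y i.1 i.2 = t i) ∧
      ∀ y ∈ H, (∀ i ∈ I, y i.1 i.2 = 0) → y = 0 := by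
  classical
  let surj : Finset (m × m) → Prop := fun I => ∀ t : m × m → K, ∃ y ∈ H, ∀ i ∈ I, y i.1 i.2 = t i
  obtain ⟨I, hI⟩ := (Set.toFinite {I | surj I}).exists_maximal
    ⟨∅, fun t => ⟨0, zero_mem _, by simp⟩⟩
  have hsurj : surj I := hI.prop
  have hinj : ∀ y ∈ H, (∀ i ∈ I, y i.1 i.2 = 0) → y = 0 := by
    intro x hx hx0
    by_contra hne
    obtain ⟨j, hj⟩ : ∃ j : m × m, x j.1 j.2 ≠ 0 := by
      by_contra! h
      exact hne (Matrix.ext fun a b => h (a, b))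
    have hjI : j ∉ I := fun h => hj (hx0 j h)
    have : surj (insert j I) := by
      intro t
      obtain ⟨y, hy, hyt⟩ := hsurj t
      refine ⟨y + ((t j - y j.1 j.2) / x j.1 j.2) • x, add_mem hy (H.smul_mem _ hx), ?_⟩
      intro i hi
      rcases Finset.mem_insert.1 hi with rfl | hi
      · simp [div_mul_cancel₀ _ hj]
      · simp [hx0 i hi, hyt i hi]
    exact hjI (hI.le_of_ge this (Finset.subset_insert _ _) (Finset.mem_insert_self _ _))
  refine ⟨I, ?_, hsurj, hinj⟩
  let r : H →ₗ[K] (I → K) :=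
    { toFun := fun y i => (y : Matrix m m K) i.1.1 i.1.2
      map_add' := fun _ _ => rfl
      map_smul' := fun _ _ => rfl }
  have hr : Function.Bijective r := by
    constructor
    · rw [← LinearMap.ker_eq_bot, LinearMap.ker_eq_bot']
      intro y hy
      exact Subtype.ext (hinj y y.2 fun i hi => congrFun hy ⟨i, hi⟩)
    · intro t
      obtain ⟨y, hy, h⟩ := hsurj fun i => if hi : i ∈ I then t ⟨i, hi⟩ else 0
      refine ⟨⟨y, hy⟩, funext fun i => ?_⟩
      exact (h i.1 i.2).trans (by simp)
  rw [(LinearEquiv.ofBijective r hr).finrank_eq]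
  simp

/-- A space of matrices containing an invertible one contains an invertible one whose coordinates
lie in a prescribed infinite set. -/
theorem exists_isUnit_mem_of_pivots (H : Submodule K (Matrix m m K)) (I : Finset (m × m))
    (hsurj : ∀ t : m × m → K, ∃ y ∈ H, ∀ i ∈ I, y i.1 i.2 = t i)
    (hinj : ∀ y ∈ H, (∀ i ∈ I, y i.1 i.2 = 0) → y = 0) (s : Set K) (hs : s.Infinite)
    [DecidableEq m] (h : Matrix m m K) (hH : h ∈ H) (hu : IsUnit h.det) :
    ∃ y ∈ H, IsUnit y.det ∧ ∀ i ∈ I, y i.1 i.2 ∈ s := by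
  classical
  choose! B hB hBI using fun j : m × m => hsurj (Pi.single j 1)
  have huniq : ∀ y ∈ H, y = ∑ j ∈ I, y j.1 j.2 • B j := by
    intro y hy
    rw [← sub_eq_zero]
    refine hinj _ (sub_mem hy (Submodule.sum_mem _ fun j _ => H.smul_mem _ (hB j))) ?_
    intro i hi
    rw [Matrix.sub_apply, Matrix.sum_apply, sub_eq_zero]
    simp only [Matrix.smul_apply, smul_eq_mul]
    rw [Finset.sum_eq_single i]
    · rw [hBI i i hi, Pi.single_eq_same, mul_one]
    · intro j hj hji
      rw [hBI j i hi, Pi.single_eq_of_ne (Ne.symm hji), mul_zero]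
    · exact fun h => absurd hi h
  let P : MvPolynomial (m × m) K :=
    (Matrix.of fun a b => ∑ j ∈ I, MvPolynomial.X j * MvPolynomial.C (B j a b)).det
  have hP : ∀ t : m × m → K, MvPolynomial.eval t P = (∑ j ∈ I, t j • B j).det := by
    intro t
    simp only [P]
    rw [RingHom.map_det]
    congr 1
    ext a b
    simp [Matrix.sum_apply]
  have hP0 : P ≠ 0 := by
    intro h0
    have h1 := hP fun j => h j.1 j.2
    rw [h0, map_zero, ← huniq h hH] at h1
    exact hu.ne_zero h1.symm
  obtain ⟨t, ht, htP⟩ : ∃ t ∈ Set.univ.pi (fun _ : m × m => s), MvPolynomial.eval t P ≠ 0 := by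
    by_contra! hcon
    exact hP0 (MvPolynomial.funext_set (fun _ => s) (fun _ => hs) (by simpa using hcon))
  have hmem : ∑ j ∈ I, t j • B j ∈ H := Submodule.sum_mem _ fun j _ => H.smul_mem _ (hB j)
  refine ⟨_, hmem, by rw [← hP]; exact isUnit_iff_ne_zero.2 htP, ?_⟩
  intro i hi
  rw [Matrix.sum_apply, Finset.sum_eq_single i]
  · rw [Matrix.smul_apply, hBI i i hi, Pi.single_eq_same, smul_eq_mul, mul_one]
    exact ht i trivial
  · intro j hj hji
    rw [Matrix.smul_apply, hBI j i hi, Pi.single_eq_of_ne (Ne.symm hji), smul_zero]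
  · exact fun h => absurd hi h

/-- A solution of a Sylvester equation with coefficients in a subfield is determined over this
subfield by its pivot entries. -/
theorem mem_subfield_of_pivots (F : Subfield K) {A B y : Matrix m m K} (hA : ∀ i j, A i j ∈ F)
    (hB : ∀ i j, B i j ∈ F) (I : Finset (m × m)) (hy : A * y = y * B)
    (hinj : ∀ y : Matrix m m K, A * y = y * B → (∀ i ∈ I, y i.1 i.2 = 0) → y = 0)
    (hyI : ∀ i ∈ I, y i.1 i.2 ∈ F) (i j : m) : y i j ∈ F := by
  obtain ⟨π, hπ⟩ := LinearMap.exists_leftInverse_of_injective (Algebra.linearMap F K)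
    (LinearMap.ker_eq_bot.2 (algebraMap F K).injective)
  have hπF : ∀ x : F, π x = x := fun x => LinearMap.congr_fun hπ x
  let y' : Matrix m m K := Matrix.of fun a b => (π (y a b) : K)
  have hmul : ∀ (c : F) (x : K), (π (c * x) : K) = c * π x := by
    intro c x
    have := π.map_smul c x
    rw [Algebra.smul_def] at this
    exact (congrArg Subtype.val this).trans rfl
  have hy' : A * y' = y' * B := by
    ext a b
    have h := congrArg (fun x => (π x : K)) (congrFun (congrFun hy a) b)
    simp only [Matrix.mul_apply, map_sum, AddSubmonoidClass.coe_finsetSum] at h ⊢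
    convert h using 2 with c _ c _
    · exact (hmul ⟨A a c, hA a c⟩ (y c b)).symm
    · rw [mul_comm (y a c), mul_comm]
      exact (hmul ⟨B c b, hB c b⟩ (y a c)).symm
  have h0 : y - y' = 0 := by
    apply hinj
    · rw [mul_sub, sub_mul, hy, hy']
    · intro i hi
      rw [Matrix.sub_apply, sub_eq_zero]
      exact (congrArg Subtype.val (hπF ⟨_, hyI i hi⟩)).symm
  rw [sub_eq_zero.1 h0]
  exact (π (y i j)).2

end Pivots

section GeneratorCount

open Polynomial

/-- The smallest subfield of `K` that is algebraically closed in `K`. -/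
def absoluteAlgebraicClosure (K : Type*) [Field K] : Subfield K :=
  sInf {F : Subfield K | ∀ x, IsAlgebraic F x → x ∈ F}

theorem mem_absoluteAlgebraicClosure_of_isIntegral {K : Type*} [Field K] {x : K}
    (hx : IsIntegral ℤ x) :
    x ∈ absoluteAlgebraicClosure K := by
  rw [absoluteAlgebraicClosure, Subfield.mem_sInf]
  intro F hF
  exact hF x (hx.tower_top (A := F)).isAlgebraic

variable {K : Type*} [Field K] [IsAlgClosed K] {n : ℕ}

theorem isIntegral_int_of_mem_spectrum {r : ℕ} (hr : 2 ≤ r) {M g : Matrix (Fin n) (Fin n) K}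
    (hg : IsUnit g) (h : M ^ r * g = g * M) {c : K} (hc : c ∈ spectrum K M) : IsIntegral ℤ c := by
  obtain ⟨u, rfl⟩ := hg
  have hM : spectrum K (M ^ r) = spectrum K M := by
    have : M ^ r = u * M * (↑u⁻¹ : Matrix (Fin n) (Fin n) K) := by
      rw [← h, mul_assoc, Units.mul_inv, mul_one]
    rw [this, spectrum.units_conjugate]
  have hfin : (spectrum K M).Finite := by
    rw [← Matrix.spectrum_toLin']
    exact Module.End.finite_spectrum _
  have hpow : ∀ k : ℕ, c ^ r ^ k ∈ spectrum K M := by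
    intro k
    induction k with
    | zero => simpa using hc
    | succ k ih =>
      rw [← hM, spectrum.map_pow_of_pos M (by omega), pow_succ, pow_mul]
      exact ⟨_, ih, rfl⟩
  obtain ⟨a, b, hab, e⟩ : ∃ a b, a < b ∧ c ^ r ^ a = c ^ r ^ b := by
    have := hfin.to_subtype
    obtain ⟨a, b, hab, e⟩ := Finite.exists_ne_map_eq_of_infinite
      (fun k : ℕ => (⟨_, hpow k⟩ : spectrum K M))
    rcases lt_or_gt_of_ne hab with hlt | hlt
    · exact ⟨a, b, hlt, congrArg Subtype.val e⟩
    · exact ⟨b, a, hlt, (congrArg Subtype.val e).symm⟩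
  have hlt : r ^ a < r ^ b := Nat.pow_lt_pow_right (by omega) hab
  refine ⟨X ^ r ^ b - X ^ r ^ a, ?_, by simp [e]⟩
  exact monic_X_pow_sub (by rw [degree_X_pow]; exact_mod_cast hlt)

theorem infinite_absoluteAlgebraicClosure :
    (absoluteAlgebraicClosure K : Set K).Infinite := by
  intro hfin
  have : Fintype (absoluteAlgebraicClosure K) := hfin.fintype
  let N := Fintype.card (absoluteAlgebraicClosure K)
  have hN : 1 < N := Fintype.one_lt_card
  have hdeg : (X - 1 : K[X]).degree < (N : ℕ) := by
    rw [← C_1, degree_X_sub_C]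
    exact_mod_cast hN
  obtain ⟨x, hx⟩ := IsAlgClosed.exists_root (X ^ N - (X - 1) : K[X]) (by
    rw [degree_sub_eq_left_of_degree_lt (by rwa [degree_X_pow]), degree_X_pow]
    exact_mod_cast (by omega))
  have hroot : x ^ N - (x - 1) = 0 := by simpa using hx
  have hmem : x ∈ absoluteAlgebraicClosure K := by
    apply mem_absoluteAlgebraicClosure_of_isIntegral
    refine ⟨X ^ N - (X - 1), ?_, by simpa using hroot⟩
    refine monic_X_pow_sub ?_
    rw [← C_1, degree_X_sub_C]
    exact_mod_cast hN
  have h2 : x ^ N = x := congrArg Subtype.val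
    (FiniteField.pow_card (⟨x, hmem⟩ : absoluteAlgebraicClosure K))
  rw [h2] at hroot
  simp at hroot

/-- A matrix with eigenvalues in a subfield is similar to a matrix over this subfield. -/
theorem exists_similar_matrix (F : Subfield K) (M : Matrix (Fin n) (Fin n) K)
    (hF : ∀ c ∈ spectrum K M, c ∈ F) :
    ∃ J h : Matrix (Fin n) (Fin n) K, IsUnit h.det ∧ M * h = h * J ∧ ∀ i j, J i j ∈ F := by
  obtain ⟨b', hb'⟩ := exists_basis_repr_mem (Matrix.toLin' M) F (by rwa [Matrix.spectrum_toLin'])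
  let b : Module.Basis (Fin n) K (Fin n → K) := b'.reindex (finCongr (by simp))
  refine ⟨Matrix.of fun i j => b.repr (Matrix.toLin' M (b j)) i,
    Matrix.of fun a i => b i a, ?_, ?_, ?_⟩
  · have e : (Matrix.of fun a i => b i a) = (Pi.basisFun K (Fin n)).toMatrix b := by
      ext a i
      simp [Module.Basis.toMatrix_apply]
    have := (Pi.basisFun K (Fin n)).invertibleToMatrix b
    rw [e, ← Matrix.isUnit_iff_isUnit_det]
    exact isUnit_of_invertible _
  · ext a j
    have h1 := congrFun (b.sum_repr (Matrix.toLin' M (b j))) a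
    rw [Finset.sum_apply] at h1
    rw [Matrix.mul_apply, Matrix.mul_apply]
    simp only [Matrix.of_apply]
    rw [Matrix.toLin'_apply, Matrix.mulVec] at h1
    simp only [Pi.smul_apply, smul_eq_mul] at h1
    simp only [Matrix.toLin'_apply]
    refine Eq.trans ?_ (h1.symm.trans ?_)
    · rfl
    · exact Finset.sum_congr rfl fun i _ => mul_comm _ _
  · intro i j
    simp only [b, Matrix.of_apply, Module.Basis.reindex_apply, Module.Basis.repr_reindex_apply]
    exact hb' _ _

theorem exists_finset_card_le_generating {r : ℕ} (hr : 2 ≤ r) {M g : Matrix (Fin n) (Fin n) K}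
    (hg : IsUnit g.det) (h : M ^ r * g = g * M) :
    ∃ T : Finset K, T.card ≤ n * n ∧ ∀ F : Subfield K, (∀ x, IsAlgebraic F x → x ∈ F) →
      (T : Set K) ⊆ F → ∀ i j, M i j ∈ F ∧ g i j ∈ F := by
  classical
  let F₀ := absoluteAlgebraicClosure K
  have hgu : IsUnit g := (Matrix.isUnit_iff_isUnit_det g).2 hg
  obtain ⟨J, h₀, hh₀, hMh₀, hJ⟩ := exists_similar_matrix F₀ M fun c hc =>
    mem_absoluteAlgebraicClosure_of_isIntegral (isIntegral_int_of_mem_spectrum hr hgu h hc)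
  let H₁ : Submodule K (Matrix (Fin n) (Fin n) K) :=
    LinearMap.ker (LinearMap.mulLeft K M - LinearMap.mulRight K J)
  have hH₁ : ∀ y, y ∈ H₁ ↔ M * y = y * J := fun y => by
    simp [H₁, LinearMap.mem_ker, sub_eq_zero]
  let H₂ : Submodule K (Matrix (Fin n) (Fin n) K) :=
    LinearMap.ker (LinearMap.mulLeft K (M ^ r) - LinearMap.mulRight K M)
  have hH₂ : ∀ y, y ∈ H₂ ↔ M ^ r * y = y * M := fun y => by
    simp [H₂, LinearMap.mem_ker, sub_eq_zero]
  have hJh₀ : J * h₀⁻¹ = h₀⁻¹ * M := by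
    calc J * h₀⁻¹ = h₀⁻¹ * (h₀ * J) * h₀⁻¹ := by
          rw [← mul_assoc, Matrix.nonsing_inv_mul _ hh₀, one_mul]
      _ = h₀⁻¹ * M := by
          rw [← hMh₀, mul_assoc, mul_assoc, Matrix.mul_nonsing_inv _ hh₀, mul_one]
  have hfin : Module.finrank K H₂ ≤ Module.finrank K H₁ := by
    let φ : H₂ →ₗ[K] H₁ :=
      ((LinearMap.mulLeft K g⁻¹ ∘ₗ LinearMap.mulRight K h₀) ∘ₗ H₂.subtype).codRestrict H₁ (by
        rintro ⟨y, hy⟩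
        rw [hH₂] at hy
        rw [hH₁]
        simp only [LinearMap.comp_apply, Submodule.subtype_apply, LinearMap.mulLeft_apply,
          LinearMap.mulRight_apply]
        have hgM : M * g⁻¹ = g⁻¹ * M ^ r := by
          calc M * g⁻¹ = g⁻¹ * (g * M) * g⁻¹ := by
                rw [← mul_assoc, Matrix.nonsing_inv_mul _ hg, one_mul]
            _ = g⁻¹ * M ^ r := by
                rw [← h, mul_assoc, mul_assoc, Matrix.mul_nonsing_inv _ hg, mul_one]
        rw [← mul_assoc, hgM, mul_assoc, ← mul_assoc (M ^ r), hy, mul_assoc, hMh₀, mul_assoc,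
          mul_assoc])
    refine LinearMap.finrank_le_finrank_of_injective (f := φ) ?_
    rw [← LinearMap.ker_eq_bot, LinearMap.ker_eq_bot']
    rintro ⟨y, hy⟩ h0
    have h1 : g⁻¹ * (y * h₀) = 0 := congrArg Subtype.val h0
    refine Subtype.ext ?_
    calc y = g * (g⁻¹ * (y * h₀)) * h₀⁻¹ := by
          rw [← mul_assoc, Matrix.mul_nonsing_inv _ hg, one_mul, mul_assoc,
            Matrix.mul_nonsing_inv _ hh₀, mul_one]
      _ = 0 := by rw [h1, mul_zero, zero_mul]
  obtain ⟨I₁, hI₁, hs₁, hi₁⟩ := exists_pivots H₁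
  obtain ⟨I₂, hI₂, hs₂, hi₂⟩ := exists_pivots H₂
  obtain ⟨h₁, hh₁, hu₁, hF₁⟩ := exists_isUnit_mem_of_pivots H₁ I₁ hs₁ hi₁ (F₀ : Set K)
    infinite_absoluteAlgebraicClosure h₀ ((hH₁ _).2 hMh₀) hh₀
  refine ⟨I₁ᶜ.image (fun i => h₁ i.1 i.2) ∪ I₂.image (fun i => g i.1 i.2), ?_, ?_⟩
  · refine (Finset.card_union_le _ _).trans ?_
    have h1 : (I₁ᶜ.image fun i => h₁ i.1 i.2).card ≤ I₁ᶜ.card := Finset.card_image_le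
    have h2 : (I₂.image fun i => g i.1 i.2).card ≤ I₂.card := Finset.card_image_le
    have h3 := Finset.card_add_card_compl I₁
    rw [Fintype.card_prod, Fintype.card_fin] at h3
    omega
  · intro F hF hT
    have hF₀F : F₀ ≤ F := sInf_le hF
    have hh₁F : ∀ i j, h₁ i j ∈ F := by
      intro i j
      by_cases hij : (i, j) ∈ I₁
      · exact hF₀F (hF₁ _ hij)
      · exact hT (Finset.mem_coe.2 (Finset.mem_union_left _
          (Finset.mem_image.2 ⟨(i, j), by simpa using hij, rfl⟩)))
    have hmul : ∀ A B : Matrix (Fin n) (Fin n) K, (∀ i j, A i j ∈ F) → (∀ i j, B i j ∈ F) →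
        ∀ i j, (A * B) i j ∈ F := fun A B hA hB i j => by
      rw [Matrix.mul_apply]
      exact sum_mem fun k _ => mul_mem (hA _ _) (hB _ _)
    have hinv : ∀ i j, h₁⁻¹ i j ∈ F := by
      have e : h₁ = (Matrix.of fun i j => (⟨h₁ i j, hh₁F i j⟩ : F)).map F.subtype := by
        ext i j; rfl
      intro i j
      rw [e, Matrix.inv_def]
      have : Ring.inverse (Matrix.det ((Matrix.of fun i j => (⟨h₁ i j, hh₁F i j⟩ : F)).map F.subtype))
          ∈ F := by
        rw [Ring.inverse_eq_inv', ← RingHom.mapMatrix_apply, ← RingHom.map_det]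
        exact inv_mem (Subtype.property _)
      rw [Matrix.smul_apply, smul_eq_mul]
      refine mul_mem this ?_
      rw [← RingHom.mapMatrix_apply, ← RingHom.map_adjugate]
      exact Subtype.property _
    have hM : M = h₁ * J * h₁⁻¹ := by
      rw [← (hH₁ _).1 hh₁, mul_assoc, Matrix.mul_nonsing_inv _ hu₁, mul_one]
    have hMF : ∀ i j, M i j ∈ F := by
      rw [hM]
      exact hmul _ _ (hmul _ _ hh₁F fun i j => hF₀F (hJ i j)) hinv
    have hMr : ∀ k, ∀ i j, (M ^ k) i j ∈ F := by
      intro k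
      induction k with
      | zero =>
        intro i j
        rw [pow_zero, Matrix.one_apply]
        split_ifs
        exacts [one_mem _, zero_mem _]
      | succ k ih => rw [pow_succ]; exact hmul _ _ ih hMF
    intro i j
    refine ⟨hMF i j, mem_subfield_of_pivots F (hMr r) hMF I₂ h
      (fun y hy => hi₂ y ((hH₂ y).2 hy)) (fun i hi => ?_) i j⟩
    exact hT (Finset.mem_coe.2 (Finset.mem_union_right _ (Finset.mem_image.2 ⟨i, hi, rfl⟩)))

end GeneratorCount

section KrullDimension

theorem ringKrullDim_le_of_isIntegral {R S : Type*} [CommRing R] [CommRing S] (g : R →+* S)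
    (hg : g.IsIntegral) : ringKrullDim S ≤ ringKrullDim R := by
  algebraize [g]
  have : Algebra.IsIntegral R S := ⟨hg⟩
  refine Order.krullDim_le_of_strictMono (PrimeSpectrum.comap (algebraMap R S)) fun P Q h => ?_
  exact Ideal.IsIntegral.comap_lt_comap (I := P.asIdeal) (J := Q.asIdeal) h

theorem encard_le_of_isAlgebraic_adjoin {k Ω : Type*} [Field k] [Field Ω] [Algebra k Ω]
    {s : Set Ω} (hs : AlgebraicIndepOn k id s) (T : Set Ω)
    (h : ∀ x ∈ s, IsAlgebraic (Algebra.adjoin k T) x) : s.encard ≤ T.encard := by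
  let M := AlgebraicIndependent.matroid k Ω
  have h₁ : M.Indep s := AlgebraicIndependent.matroid_indep_iff.2 hs
  have h₂ : s ⊆ M.closure T := by
    rw [AlgebraicIndependent.matroid_closure_eq]
    exact fun x hx => (Subalgebra.mem_algebraicClosure _ _).2 (h x hx)
  calc s.encard ≤ M.eRk (M.closure T) := h₁.encard_le_eRk_of_subset h₂
    _ = M.eRk T := M.eRk_closure_eq T
    _ ≤ T.encard := M.eRk_le_encard T

theorem ringKrullDim_le_card_of_isAlgebraic {k D Ω : Type*} [Field k] [CommRing D] [Algebra k D]
    [Algebra.FiniteType k D] [Field Ω] [Algebra k Ω] (f : D →ₐ[k] Ω) (hf : Function.Injective f)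
    (T : Finset Ω) (h : ∀ d, IsAlgebraic (Algebra.adjoin k (T : Set Ω)) (f d)) :
    ringKrullDim D ≤ T.card := by
  have := f.toRingHom.domain_nontrivial
  obtain ⟨s, g, hg, hint⟩ := exists_integral_inj_algHom_of_fg k D
  have hx : AlgebraicIndependent k fun i : Fin s => f (g (MvPolynomial.X i)) := by
    have := (MvPolynomial.algebraicIndependent_X (Fin s) k).map' (f := f.comp g)
      (hf.comp hg)
    exact this
  have hs : (s : ℕ∞) ≤ T.card := by
    have := encard_le_of_isAlgebraic_adjoin hx.to_subtype_range (T : Set Ω) <| by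
      rintro _ ⟨i, rfl⟩
      exact h _
    rw [← Set.image_univ, hx.injective.encard_image, Set.encard_univ, ENat.card_eq_coe_natCard,
      Nat.card_fin, Set.encard_coe_eq_coe_finsetCard] at this
    exact this
  calc ringKrullDim D ≤ ringKrullDim (MvPolynomial (Fin s) k) :=
        ringKrullDim_le_of_isIntegral g.toRingHom hint
    _ = s := by
        rw [MvPolynomial.ringKrullDim_of_isNoetherianRing, ringKrullDim_eq_zero_of_field]
        simp
    _ ≤ T.card := by exact_mod_cast hs

/-- The elements algebraic over a subalgebra form a subfield. -/
def subfieldOfIsAlgebraic {k Ω : Type*} [Field k] [Field Ω] [Algebra k Ω] (A : Subalgebra k Ω) :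
    Subfield Ω where
  toSubring := (Subalgebra.algebraicClosure A Ω).toSubring
  inv_mem' _ h := IsAlgebraic.inv h

theorem mem_subfieldOfIsAlgebraic {k Ω : Type*} [Field k] [Field Ω] [Algebra k Ω]
    {A : Subalgebra k Ω} {x : Ω} : x ∈ subfieldOfIsAlgebraic A ↔ IsAlgebraic A x :=
  Iff.rfl

theorem mem_subfieldOfIsAlgebraic_of_isAlgebraic {k Ω : Type*} [Field k] [Field Ω] [Algebra k Ω]
    {A : Subalgebra k Ω} {x : Ω} (hx : IsAlgebraic (subfieldOfIsAlgebraic A) x) :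
    x ∈ subfieldOfIsAlgebraic A := by
  have : IsAlgebraic (Subalgebra.algebraicClosure A Ω) x := hx
  exact this.restrictScalars A

end KrullDimension

section BlockDimension

theorem ringKrullDim_le_of_adjoin_eq_top {k D : Type*} [Field k] [CommRing D] [IsDomain D]
    [Algebra k D] {n r : ℕ} (hr : 2 ≤ r) {M g : Matrix (Fin n) (Fin n) D} (hg : g.det ≠ 0)
    (h : M ^ r * g = g * M)
    (hgen : Algebra.adjoin k (Set.range (fun ij : Fin n × Fin n => M ij.1 ij.2) ∪
      Set.range fun ij : Fin n × Fin n => g ij.1 ij.2) = ⊤) :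
    ringKrullDim D ≤ (n * n : ℕ) := by
  have : Algebra.FiniteType k D :=
    ⟨Subalgebra.fg_def.2 ⟨_, (Set.finite_range _).union (Set.finite_range _), hgen⟩⟩
  let Ω := AlgebraicClosure (FractionRing D)
  let f : D →ₐ[k] Ω := IsScalarTower.toAlgHom k D Ω
  have hf : Function.Injective f := by
    have := (algebraMap (FractionRing D) Ω).injective.comp (IsFractionRing.injective D _)
    rwa [← RingHom.coe_comp, ← IsScalarTower.algebraMap_eq] at this
  obtain ⟨T, hT, hTF⟩ := exists_finset_card_le_generating (K := Ω) hr
    (M := M.map f) (g := g.map f)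
    (by
      have : (g.map f).det = f g.det := (AlgHom.map_det f g).symm
      rw [this, isUnit_iff_ne_zero]
      exact (map_ne_zero_iff f hf).2 hg)
    (by
      have := congrArg f.mapMatrix h
      simp only [map_mul, map_pow] at this
      exact this)
  refine (ringKrullDim_le_card_of_isAlgebraic f hf T fun d => ?_).trans (by exact_mod_cast hT)
  have hF := hTF (subfieldOfIsAlgebraic (Algebra.adjoin k (T : Set Ω)))
    (fun x => mem_subfieldOfIsAlgebraic_of_isAlgebraic)
    (fun x hx => isAlgebraic_algebraMap
      (⟨x, Algebra.subset_adjoin hx⟩ : Algebra.adjoin k (T : Set Ω)))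
  have hd : d ∈ Algebra.adjoin k (Set.range (fun ij : Fin n × Fin n => M ij.1 ij.2) ∪
      Set.range fun ij : Fin n × Fin n => g ij.1 ij.2) := hgen ▸ Algebra.mem_top
  induction hd using Algebra.adjoin_induction with
  | mem x hx =>
    rcases hx with ⟨ij, rfl⟩ | ⟨ij, rfl⟩
    · exact (hF ij.1 ij.2).1
    · exact (hF ij.1 ij.2).2
  | algebraMap c =>
    rw [AlgHom.commutes]
    exact isAlgebraic_algebraMap (algebraMap k (Algebra.adjoin k (T : Set Ω)) c)
  | add x y _ _ hx hy => rw [map_add]; exact hx.add hy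
  | mul x y _ _ hx hy => rw [map_mul]; exact hx.mul hy

end BlockDimension

section LocalDimension

theorem height_le_of_ringKrullDim_quotient_le {C : Type*} [CommRing C] {P : Ideal C} [P.IsPrime]
    {N : ℕ} (h : ∀ Q : Ideal C, Q.IsPrime → Q ≤ P → ringKrullDim (C ⧸ Q) ≤ N) :
    P.height ≤ N := by
  have := PrimeSpectrum.height_eq_orderHeight ⟨P, ‹_›⟩
  change P.height = _ at this
  rw [this]
  refine Order.height_le fun c hc => ?_
  have hle : ∀ i, c.head ≤ c i := fun i => LTSeries.head_le c i
  let c' : LTSeries (PrimeSpectrum.zeroLocus (c.head.asIdeal : Set C)) :=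
    { length := c.length
      toFun := fun i => ⟨c i, hle i⟩
      step := fun i => c.step i }
  have hd := h c.head.asIdeal c.head.2
    (by have := LTSeries.head_le_last c; rw [hc] at this; exact this)
  rw [ringKrullDim_quotient] at hd
  have := (Order.LTSeries.length_le_krullDim c').trans hd
  exact_mod_cast this

theorem ringKrullDim_le_of_pow_mul_eq_mul {k E : Type*} [Field k] [CommRing E]
    [IsNoetherianRing E] [IsLocalRing E] [Algebra k E] {n r : ℕ} (hr : 2 ≤ r)
    {M g : Matrix (Fin n) (Fin n) E} (hg : IsUnit g.det) (h : M ^ r * g = g * M)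
    (hM : ∀ i j, (M - 1) i j ∈ IsLocalRing.maximalIdeal E)
    (hg₁ : ∀ i j, (g - 1) i j ∈ IsLocalRing.maximalIdeal E)
    (hmax : ∀ Q : Ideal E, Q.IsPrime → (∀ i j, (M - 1) i j ∈ Q) → (∀ i j, (g - 1) i j ∈ Q) →
      Q = IsLocalRing.maximalIdeal E) :
    ringKrullDim E ≤ (n * n : ℕ) := by
  classical
  let s : Set E := Set.range (fun ij : Fin n × Fin n => M ij.1 ij.2) ∪
      Set.range fun ij : Fin n × Fin n => g ij.1 ij.2
  have hs : s.Finite := (Set.finite_range _).union (Set.finite_range _)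
  let C := Algebra.adjoin k s
  have : Algebra.FiniteType k C :=
    (Subalgebra.fg_iff_finiteType _).1 (Subalgebra.fg_def.2 ⟨s, hs, rfl⟩)
  have : IsNoetherianRing C := Algebra.FiniteType.isNoetherianRing k C
  let ι : C →+* E := C.val.toRingHom
  have hι : Function.Injective ι := Subtype.val_injective
  let M' : Matrix (Fin n) (Fin n) C := Matrix.of fun i j =>
    ⟨M i j, Algebra.subset_adjoin (Or.inl ⟨(i, j), rfl⟩)⟩
  let g' : Matrix (Fin n) (Fin n) C := Matrix.of fun i j =>
    ⟨g i j, Algebra.subset_adjoin (Or.inr ⟨(i, j), rfl⟩)⟩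
  have hM' : ι.mapMatrix M' = M := rfl
  have hg' : ι.mapMatrix g' = g := rfl
  have hrel : M' ^ r * g' = g' * M' := by
    apply Matrix.map_injective hι
    change ι.mapMatrix _ = ι.mapMatrix _
    rw [map_mul, map_pow, map_mul, hM', hg', h]
  have hgen : Algebra.adjoin k (Set.range (fun ij : Fin n × Fin n => M' ij.1 ij.2) ∪
      Set.range fun ij : Fin n × Fin n => g' ij.1 ij.2) = ⊤ := by
    rw [← Algebra.adjoin_adjoin_coe_preimage (R := k) (s := s)]
    congr 1
    ext x
    simp only [s, M', g', Set.mem_union, Set.mem_range, Set.mem_preimage, Subtype.ext_iff,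
      Matrix.of_apply]
  let P : Ideal C := (IsLocalRing.maximalIdeal E).comap ι
  have hP : P.IsPrime := Ideal.comap_isPrime _ _
  have hdet : g'.det ∉ P := fun hd => by
    have : ι g'.det ∈ IsLocalRing.maximalIdeal E := hd
    rw [RingHom.map_det, hg'] at this
    exact (IsLocalRing.mem_maximalIdeal _).1 this hg
  have hht : P.height ≤ (n * n : ℕ) := by
    refine height_le_of_ringKrullDim_quotient_le fun Q hQ hQP => ?_
    let π : C →ₐ[k] C ⧸ Q := Ideal.Quotient.mkₐ k Q
    refine ringKrullDim_le_of_adjoin_eq_top (k := k) hr (M := M'.map π) (g := g'.map π) ?_ ?_ ?_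
    · have : (g'.map π).det = π g'.det := (AlgHom.map_det π g').symm
      rw [this]
      exact fun h0 => hdet (hQP (Ideal.Quotient.eq_zero_iff_mem.1 h0))
    · have := congrArg π.mapMatrix hrel
      simp only [map_mul, map_pow] at this
      exact this
    · have := congrArg (Subalgebra.map π) hgen
      rw [← Algebra.adjoin_image, Set.image_union, ← Set.range_comp, ← Set.range_comp,
        Algebra.map_top, (AlgHom.range_eq_top π).2 (Ideal.Quotient.mkₐ_surjective k Q)] at this
      exact this
  obtain ⟨y, hy, hcard⟩ := Ideal.exists_finset_card_eq_height_of_isNoetherianRing P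
  have hmin : IsLocalRing.maximalIdeal E ∈
      (Ideal.span ((y.image ι : Finset E) : Set E)).minimalPrimes := by
    refine ⟨⟨inferInstance, Ideal.span_le.2 ?_⟩, fun Q ⟨hQ, hyQ⟩ hQm => ?_⟩
    · intro x hx
      obtain ⟨c, hc, rfl⟩ := Finset.mem_image.1 hx
      exact hy.1.2 (Ideal.subset_span hc)
    · have hPQ : P ≤ Q.comap ι := hy.2
        ⟨Ideal.comap_isPrime _ _, Ideal.span_le.2 fun c hc =>
          hyQ (Ideal.subset_span (Finset.mem_image_of_mem ι hc))⟩ (Ideal.comap_mono hQm)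
      refine (hmax Q hQ (fun i j => ?_) fun i j => ?_).ge
      · have : (M' - 1) i j ∈ P := by
          change ι.mapMatrix (M' - 1) i j ∈ IsLocalRing.maximalIdeal E
          rw [map_sub, map_one, hM']
          exact hM i j
        have : ι.mapMatrix (M' - 1) i j ∈ Q := hPQ this
        rwa [map_sub, map_one, hM'] at this
      · have : (g' - 1) i j ∈ P := by
          change ι.mapMatrix (g' - 1) i j ∈ IsLocalRing.maximalIdeal E
          rw [map_sub, map_one, hg']
          exact hg₁ i j
        have : ι.mapMatrix (g' - 1) i j ∈ Q := hPQ this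
        rwa [map_sub, map_one, hg'] at this
  rw [← IsLocalRing.maximalIdeal_height_eq_ringKrullDim]
  have h₁ := Ideal.height_le_card_of_mem_minimalPrimes_span_finset hmin
  have h₂ : ((y.image ι).card : ℕ∞) ≤ y.card := by exact_mod_cast Finset.card_image_le
  exact_mod_cast (h₁.trans h₂).trans (hcard.le.trans hht)

end LocalDimension

section RelationMatrix

open IsLocalRing

theorem mapMatrix_inv_of_isUnit_det {R S : Type*} [CommRing R] [CommRing S] {n : ℕ} (f : R →+* S)
    {A : Matrix (Fin n) (Fin n) R} (hA : IsUnit A.det) :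
    f.mapMatrix A⁻¹ = (f.mapMatrix A)⁻¹ := by
  symm
  apply Matrix.inv_eq_left_inv
  rw [← map_mul, Matrix.nonsing_inv_mul _ hA, map_one]

theorem mapMatrix_matComm {R S : Type*} [CommRing R] [CommRing S] {n : ℕ} (f : R →+* S)
    {A B : Matrix (Fin n) (Fin n) R} (hA : IsUnit A.det) (hB : IsUnit B.det) :
    f.mapMatrix (matComm A B) = matComm (f.mapMatrix A) (f.mapMatrix B) := by
  rw [matComm, matComm, map_mul, map_mul, map_mul, mapMatrix_inv_of_isUnit_det f hA,
    mapMatrix_inv_of_isUnit_det f hB]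

theorem matComm_one_one {R : Type*} [CommRing R] {n : ℕ} :
    matComm (1 : Matrix (Fin n) (Fin n) R) 1 = 1 := by
  simp [matComm]

variable {A : Type*} [CommRing A]

theorem mapMatrix_constantCoeff_Xt (N n : ℕ) (k : Fin N) :
    (MvPowerSeries.constantCoeff (σ := Fin N × Fin n × Fin n) (R := A)).mapMatrix (Xt N n k) =
      1 := by
  rw [Xt, map_add, map_one, add_eq_left]
  ext i j
  exact MvPowerSeries.constantCoeff_X _

theorem isUnit_det_Xt (N n : ℕ) (k : Fin N) : IsUnit (Xt (A := A) N n k).det := by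
  rw [MvPowerSeries.isUnit_iff_constantCoeff, RingHom.map_det, mapMatrix_constantCoeff_Xt,
    Matrix.det_one]
  exact isUnit_one

theorem mapMatrix_relMatrix {E : Type*} [CommRing E] (q m n : ℕ)
    (f : MvPowerSeries (Fin (2 * m + 2) × Fin n × Fin n) A →+* E)
    (hf : ∀ (k : Fin (2 * m)) (i j : Fin n), f (MvPowerSeries.X (k.addNat 2, i, j)) = 0) :
    f.mapMatrix (relMatrix q m n) = f.mapMatrix (Xt (2 * m + 2) n ⟨0, by omega⟩) ^ q *
      matComm (f.mapMatrix (Xt (2 * m + 2) n ⟨0, by omega⟩))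
        (f.mapMatrix (Xt (2 * m + 2) n ⟨1, by omega⟩)) := by
  have hX : ∀ (k : ℕ) (hk : k < 2 * m + 2), 2 ≤ k → f.mapMatrix (Xt (2 * m + 2) n ⟨k, hk⟩) = 1 := by
    intro k hk h2
    rw [Xt, map_add, map_one, add_eq_left]
    ext i j
    have := hf ⟨k - 2, by omega⟩ i j
    rw [show (⟨k - 2, by omega⟩ : Fin (2 * m)).addNat 2 = (⟨k, hk⟩ : Fin (2 * m + 2)) by
      ext; simp; omega] at this
    exact this
  rw [relMatrix, map_mul, map_pow, List.ofFn_succ, List.prod_cons, map_mul,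
    mapMatrix_matComm f (isUnit_det_Xt _ _ _) (isUnit_det_Xt _ _ _), map_list_prod]
  rw [List.prod_eq_one, mul_one]
  · rfl
  · intro x hx
    rw [List.map_ofFn, List.mem_ofFn] at hx
    obtain ⟨i, rfl⟩ := hx
    rw [Function.comp_apply, mapMatrix_matComm f (isUnit_det_Xt _ _ _) (isUnit_det_Xt _ _ _),
      hX _ _ (by simp), hX _ _ (by simp; omega), matComm_one_one]

theorem pow_succ_mul_eq_of_matComm {R : Type*} [CommRing R] {n q : ℕ}
    {M g : Matrix (Fin n) (Fin n) R} (hM : IsUnit M.det) (hg : IsUnit g.det)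
    (h : M ^ q * matComm M g = 1) : M ^ (q + 1) * g = g * M := by
  have e : M ^ (q + 1) * g = M ^ q * matComm M g * (g * M) := by
    rw [matComm, pow_succ]
    simp only [mul_assoc]
    rw [Matrix.nonsing_inv_mul_cancel_left _ _ hg, Matrix.nonsing_inv_mul _ hM, mul_one]
  rw [e, h, one_mul]

theorem constantCoeff_relMatrix (q m n : ℕ) :
    MvPowerSeries.constantCoeff.mapMatrix (relMatrix (A := A) q m n) = 1 := by
  rw [mapMatrix_relMatrix q m n _ fun k i j => MvPowerSeries.constantCoeff_X _]
  simp only [mapMatrix_constantCoeff_Xt, one_pow, matComm_one_one, mul_one]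

variable [IsLocalRing A]

theorem mem_maximalIdeal_mvPowerSeries_iff {σ : Type*} {f : MvPowerSeries σ A} :
    f ∈ maximalIdeal (MvPowerSeries σ A) ↔ MvPowerSeries.constantCoeff f ∈ maximalIdeal A := by
  rw [mem_maximalIdeal, mem_maximalIdeal, mem_nonunits_iff, mem_nonunits_iff,
    MvPowerSeries.isUnit_iff_constantCoeff]

theorem X_mem_maximalIdeal {σ : Type*} (i : σ) :
    (MvPowerSeries.X i : MvPowerSeries σ A) ∈ maximalIdeal (MvPowerSeries σ A) := by
  rw [mem_maximalIdeal_mvPowerSeries_iff, MvPowerSeries.constantCoeff_X]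
  exact zero_mem _

theorem relMatrix_sub_one_mem_maximalIdeal (q m n : ℕ) (i j : Fin n) :
    (relMatrix (A := A) q m n - 1) i j ∈ maximalIdeal _ := by
  rw [mem_maximalIdeal_mvPowerSeries_iff]
  have : MvPowerSeries.constantCoeff.mapMatrix (relMatrix (A := A) q m n - 1) i j = 0 := by
    rw [map_sub, constantCoeff_relMatrix, map_one, sub_self, Matrix.zero_apply]
  change MvPowerSeries.constantCoeff.mapMatrix (relMatrix (A := A) q m n - 1) i j ∈ _
  rw [this]
  exact zero_mem _

theorem maximalIdeal_le_of_X_mem {σ : Type*} [Finite σ] {Q : Ideal (MvPowerSeries σ A)}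
    (hX : ∀ i, MvPowerSeries.X i ∈ Q) (hC : ∀ c ∈ maximalIdeal A, MvPowerSeries.C c ∈ Q) :
    maximalIdeal (MvPowerSeries σ A) ≤ Q := by
  classical
  have := Fintype.ofFinite σ
  intro f hf
  rw [mem_maximalIdeal_mvPowerSeries_iff] at hf
  rw [← sub_add_cancel f (MvPowerSeries.C (MvPowerSeries.constantCoeff f))]
  refine add_mem ?_ (hC _ hf)
  have : f - MvPowerSeries.C (MvPowerSeries.constantCoeff f) ∈
      Ideal.ofList ((Finset.univ : Finset σ).toList.map MvPowerSeries.X) := by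
    rw [MvPowerSeries.mem_span_X_iff]
    intro d hd
    obtain rfl : d = 0 := by
      ext i
      exact hd i (by simp)
    simp
  refine Ideal.span_le.2 ?_ this
  intro x hx
  obtain ⟨i, _, rfl⟩ := List.mem_map.1 hx
  exact hX i

theorem ringKrullDim_quotient_le_of_relIdeal_le {p : ℕ} [Fact p.Prime] [IsNoetherianRing A]
    (hpA : ∀ P : Ideal A, P.IsPrime → (p : A) ∈ P → P.IsMaximal) {q m n : ℕ} (hq : 1 ≤ q)
    {J : Ideal (MvPowerSeries (Fin (2 * m + 2) × Fin n × Fin n) A)} (hJ : J ≤ maximalIdeal _)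
    (hrel : relIdeal q m n ≤ J)
    (hX : ∀ (k : Fin (2 * m)) (i j : Fin n), MvPowerSeries.X (k.addNat 2, i, j) ∈ J)
    (hp : (p : MvPowerSeries (Fin (2 * m + 2) × Fin n × Fin n) A) ∈ J) :
    ringKrullDim (MvPowerSeries (Fin (2 * m + 2) × Fin n × Fin n) A ⧸ J) ≤ (n * n : ℕ) := by
  let S := MvPowerSeries (Fin (2 * m + 2) × Fin n × Fin n) A
  let f : S →+* S ⧸ J := Ideal.Quotient.mk J
  have hf : Function.Surjective f := Ideal.Quotient.mk_surjective
  have : Nontrivial (S ⧸ J) :=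
    Ideal.Quotient.nontrivial_iff.2 fun h =>
      (maximalIdeal.isMaximal S).ne_top (top_le_iff.1 (h ▸ hJ))
  have : IsLocalRing (S ⧸ J) := IsLocalRing.of_surjective' f hf
  have hloc : ∀ x ∈ maximalIdeal S, f x ∈ maximalIdeal (S ⧸ J) := by
    intro x hx
    have := ((IsLocalRing.local_hom_TFAE f).out 0 2).1 (hf.isLocalHom f)
    exact this (Ideal.mem_map_of_mem f hx)
  have : CharP (S ⧸ J) p := by
    rw [CharP.charP_iff_prime_eq_zero Fact.out, ← map_natCast f]
    exact Ideal.Quotient.eq_zero_iff_mem.2 hp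
  let _ : Algebra (ZMod p) (S ⧸ J) := ZMod.algebra _ p
  let Y : Fin (2 * m + 2) → Matrix (Fin n) (Fin n) (S ⧸ J) :=
    fun k => f.mapMatrix (Xt (2 * m + 2) n k)
  have hY : ∀ k i j, (Y k - 1) i j = f (MvPowerSeries.X (k, i, j)) := by
    intro k i j
    have : Y k - 1 = f.mapMatrix (varMatrix (2 * m + 2) n k) := by
      simp only [Y, Xt, map_add, map_one, add_sub_cancel_left]
    rw [this]
    rfl
  have hdet : ∀ k, IsUnit (Y k).det := by
    intro k
    rw [← RingHom.map_det]
    exact (isUnit_det_Xt _ _ _).map f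
  have hmem : ∀ k i j, (Y k - 1) i j ∈ maximalIdeal (S ⧸ J) := fun k i j => by
    rw [hY]
    exact hloc _ (X_mem_maximalIdeal _)
  have hone : Y ⟨0, by omega⟩ ^ q * matComm (Y ⟨0, by omega⟩) (Y ⟨1, by omega⟩) = 1 := by
    rw [← mapMatrix_relMatrix q m n f fun k i j => Ideal.Quotient.eq_zero_iff_mem.2 (hX k i j),
      ← sub_eq_zero, ← map_one f.mapMatrix, ← map_sub]
    ext i j
    exact Ideal.Quotient.eq_zero_iff_mem.2 (hrel (Ideal.subset_span ⟨(i, j), rfl⟩))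
  refine ringKrullDim_le_of_pow_mul_eq_mul (k := ZMod p) (r := q + 1) (by omega) (hdet _)
    (pow_succ_mul_eq_of_matComm (hdet _) (hdet _) hone) (hmem _) (hmem _) fun Q hQ h₀ h₁ => ?_
  refine le_antisymm (le_maximalIdeal hQ.ne_top) fun x hx => ?_
  obtain ⟨x, rfl⟩ := hf x
  have hx' : x ∈ maximalIdeal S := by
    rw [mem_maximalIdeal, mem_nonunits_iff] at hx ⊢
    exact fun hu => hx (hu.map f)
  have hJQ : J ≤ Q.comap f := fun y hy => by
    rw [Ideal.mem_comap, Ideal.Quotient.eq_zero_iff_mem.2 hy]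
    exact zero_mem _
  refine maximalIdeal_le_of_X_mem (Q := Q.comap f) ?_ ?_ hx'
  · rintro ⟨⟨k, hk⟩, i, j⟩
    rcases Nat.lt_or_ge k 2 with h2 | h2
    · rw [Ideal.mem_comap, ← hY]
      interval_cases k
      · exact h₀ i j
      · exact h₁ i j
    · have := hX ⟨k - 2, by omega⟩ i j
      rw [show (⟨k - 2, by omega⟩ : Fin (2 * m)).addNat 2 = (⟨k, hk⟩ : Fin (2 * m + 2)) by
        ext; simp; omega] at this
      exact hJQ this
  · let P : Ideal A := (Q.comap f).comap MvPowerSeries.C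
    have hP : P.IsPrime := Ideal.comap_isPrime _ _
    have hpP : (p : A) ∈ P := by
      rw [Ideal.mem_comap, map_natCast]
      exact hJQ hp
    have := hpA P hP hpP
    intro c hc
    rw [← IsLocalRing.eq_maximalIdeal this] at hc
    exact hc

theorem exists_prime_of_mem_minimalPrimes_relIdeal {p : ℕ} [Fact p.Prime] [IsNoetherianRing A]
    [IsDomain A] (hpA : ∀ P : Ideal A, P.IsPrime → (p : A) ∈ P → P.IsMaximal)
    (hp₀ : (p : A) ≠ 0) (hpu : ¬ IsUnit (p : A)) {q m n : ℕ} (hq : 1 ≤ q)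
    {Q : Ideal (MvPowerSeries (Fin (2 * m + 2) × Fin n × Fin n) A)}
    (hQ : Q ∈ (relIdeal q m n).minimalPrimes) :
    ∃ P : Ideal (MvPowerSeries (Fin (2 * m + 2) × Fin n × Fin n) A), P.IsPrime ∧ Q ≤ P ∧
      (∀ (k : Fin (2 * m)) (i j : Fin n), MvPowerSeries.X (k.addNat 2, i, j) ∈ P) ∧
      (p : MvPowerSeries (Fin (2 * m + 2) × Fin n × Fin n) A) ∉ P := by
  let S := MvPowerSeries (Fin (2 * m + 2) × Fin n × Fin n) A
  have hpm : (p : S) ∈ maximalIdeal S := by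
    rw [mem_maximalIdeal_mvPowerSeries_iff, map_natCast]
    exact (mem_maximalIdeal _).2 hpu
  have hC : MvPowerSeries.C (p : A) = (p : S) := map_natCast _ p
  let rels : List S := (Finset.univ : Finset (Fin n × Fin n)).toList.map fun ij =>
    (relMatrix (A := A) q m n - 1) ij.1 ij.2
  let vars : List S := (Finset.univ : Finset (Fin (2 * m) × Fin n × Fin n)).toList.map fun kij =>
    MvPowerSeries.X (kij.1.addNat 2, kij.2.1, kij.2.2)
  have hrels : Ideal.ofList rels = relIdeal q m n := by
    rw [relIdeal, Ideal.ofList]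
    congr 1
    ext x
    simp [rels]
  have hrels_mem : ∀ x ∈ rels, x ∈ maximalIdeal S := by
    intro x hx
    obtain ⟨ij, _, rfl⟩ := List.mem_map.1 hx
    exact relMatrix_sub_one_mem_maximalIdeal q m n _ _
  have hvars_mem : ∀ x ∈ vars, x ∈ maximalIdeal S := by
    intro x hx
    obtain ⟨ij, _, rfl⟩ := List.mem_map.1 hx
    exact X_mem_maximalIdeal _
  have hall_mem : ∀ x ∈ rels ++ (vars ++ [(p : S)]), x ∈ maximalIdeal S := by
    intro x hx
    rw [List.mem_append, List.mem_append, List.mem_singleton] at hx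
    rcases hx with hx | hx | rfl
    · exact hrels_mem x hx
    · exact hvars_mem x hx
    · exact hpm
  have hdepth := (regSeq_X_C (σ := Fin (2 * m + 2) × Fin n × Fin n) hp₀).depthGE <| by
    intro x hx
    rw [List.mem_append, List.mem_singleton] at hx
    rcases hx with hx | rfl
    · obtain ⟨i, _, rfl⟩ := List.mem_map.1 hx
      exact X_mem_maximalIdeal i
    · rw [hC]
      exact hpm
  have hdim : ringKrullDim (S ⧸ (⊥ ⊔ Ideal.ofList (rels ++ (vars ++ [(p : S)])))) ≤
      (n * n : ℕ) := by
    refine ringKrullDim_quotient_le_of_relIdeal_le hpA hq ?_ ?_ (fun k i j => ?_) ?_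
    · rw [bot_sup_eq]
      exact ofList_le_maximalIdeal hall_mem
    · rw [bot_sup_eq, Ideal.ofList_append, hrels]
      exact le_sup_left
    · refine Ideal.mem_sup_right (Ideal.subset_span ?_)
      refine List.mem_append_right _ (List.mem_append_left _ (List.mem_map.2 ⟨(k, i, j), ?_, rfl⟩))
      simp
    · exact Ideal.mem_sup_right (Ideal.subset_span
        (List.mem_append_right _ (List.mem_append_right _ (List.mem_singleton_self _))))
  have hreg := hdepth.regSeq bot_le hall_mem hdim <| by
    simp only [rels, vars, List.length_append, List.length_map, Finset.length_toList,
      Finset.card_univ, Fintype.card_prod, Fintype.card_fin, List.length_singleton]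
    apply le_of_eq
    ring
  rw [regSeq_append, bot_sup_eq, hrels] at hreg
  obtain ⟨P, hP, hQP, hvP, hpP⟩ := exists_prime_of_regSeq hQ hvars_mem hreg.2
  exact ⟨P, hP, hQP, fun k i j => hvP _ (List.mem_map.2 ⟨(k, i, j), by simp, rfl⟩), hpP⟩

end RelationMatrix

section GenericFiber

theorem exists_prime_away_of_quotient {S : Type*} [CommRing S] {I : Ideal S} {x : S} (V : Set S)
    (H : ∀ Q ∈ I.minimalPrimes, ∃ P : Ideal S, P.IsPrime ∧ Q ≤ P ∧ V ⊆ P ∧ x ∉ P)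
    (T : Type*) [CommRing T] [Algebra (S ⧸ I) T]
    [IsLocalization.Away (Ideal.Quotient.mk I x) T] {q : Ideal T} (hq : q ∈ minimalPrimes T) :
    ∃ P : Ideal T, P.IsPrime ∧ q ≤ P ∧
      ∀ v ∈ V, algebraMap (S ⧸ I) T (Ideal.Quotient.mk I v) ∈ P := by
  let M := Submonoid.powers (Ideal.Quotient.mk I x)
  have hqp : q.IsPrime := hq.1.1
  have hmin : (q.under (S ⧸ I)).comap (Ideal.Quotient.mk I) ∈ I.minimalPrimes := by
    rw [Ideal.minimalPrimes_eq_comap]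
    refine ⟨_, ?_, rfl⟩
    have hq' : q ∈ ((⊥ : Ideal (S ⧸ I)).map (algebraMap (S ⧸ I) T)).minimalPrimes := by
      rw [Ideal.map_bot]
      exact hq
    rw [IsLocalization.minimalPrimes_map M] at hq'
    exact hq'
  obtain ⟨P, hP, hQP, hV, hx⟩ := H _ hmin
  have hIP : RingHom.ker (Ideal.Quotient.mk I) ≤ P := by
    rw [Ideal.mk_ker]
    exact hmin.1.2.trans hQP
  have hP' : (P.map (Ideal.Quotient.mk I)).IsPrime :=
    Ideal.map_isPrime_of_surjective Ideal.Quotient.mk_surjective hIP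
  have hcomap : (P.map (Ideal.Quotient.mk I)).comap (Ideal.Quotient.mk I) = P := by
    rw [Ideal.comap_map_of_surjective' _ Ideal.Quotient.mk_surjective, sup_eq_left.2 hIP]
  have hdisj : Disjoint (M : Set (S ⧸ I)) (P.map (Ideal.Quotient.mk I)) := by
    rw [Set.disjoint_left]
    rintro _ ⟨k, rfl⟩ hk
    have : x ∈ (P.map (Ideal.Quotient.mk I)).comap (Ideal.Quotient.mk I) := hP'.mem_of_pow_mem k hk
    exact hx (hcomap ▸ this)
  refine ⟨_, IsLocalization.isPrime_of_isPrime_disjoint M T _ hP' hdisj, ?_, fun v hv =>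
    Ideal.mem_map_of_mem _ (Ideal.mem_map_of_mem _ (hV hv))⟩
  rw [← IsLocalization.map_under M T q]
  refine Ideal.map_mono ?_
  rw [← Ideal.map_comap_of_surjective _ Ideal.Quotient.mk_surjective (q.under (S ⧸ I))]
  exact Ideal.map_mono hQP
end GenericFiber

/-- Every irreducible component of `Spec R[1/p]` meets the closed subset cut out by
the vanishing of the variables comprising `X_3, …, X_{d+2}`. -/
theorem components_meet_closed_subspace
    (p s q m n : ℕ) (hs : 1 ≤ s) (hq : q = p ^ s) (hq3 : 3 ≤ q)
    (hm : 1 ≤ m) (hn : 1 ≤ n) [Fact p.Prime]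
    (L : Type) [Field L] [Algebra ℚ_[p] L] [FiniteDimensional ℚ_[p] L]
    [Algebra ℤ_[p] L] [IsScalarTower ℤ_[p] ℚ_[p] L] :
    ∀ 𝔮 ∈ minimalPrimes (genericFiberRing p (RingOfIntegers p L) q m n),
      ∃ 𝔓 : Ideal (genericFiberRing p (RingOfIntegers p L) q m n),
        𝔓.IsPrime ∧ 𝔮 ≤ 𝔓 ∧
        ∀ (k : Fin (2 * m)) (i j : Fin n),
          algebraMap (defRing (A := RingOfIntegers p L) q m n)
              (genericFiberRing p (RingOfIntegers p L) q m n)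
              (Ideal.Quotient.mk (relIdeal (A := RingOfIntegers p L) q m n)
                (MvPowerSeries.X (k.addNat 2, i, j))) ∈ 𝔓 := by
  intro 𝔮 h𝔮
  have := isNoetherianRing_integralClosure_padicInt p L
  have := isLocalRing_integralClosure_padicInt p L
  have : IsLocalization.Away (Ideal.Quotient.mk (relIdeal (A := RingOfIntegers p L) q m n) p)
      (genericFiberRing p (RingOfIntegers p L) q m n) := by
    rw [map_natCast]
    exact Localization.isLocalization
      (M := Submonoid.powers (p : defRing (A := RingOfIntegers p L) q m n))
  obtain ⟨𝔓, h𝔓, hle, hmem⟩ := exists_prime_away_of_quotient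
    (I := relIdeal (A := RingOfIntegers p L) q m n) (x := p)
    {x | ∃ (k : Fin (2 * m)) (i j : Fin n), x = MvPowerSeries.X (k.addNat 2, i, j)}
    (fun Q hQ => by
      obtain ⟨P, hP, hQP, hX, hp⟩ := exists_prime_of_mem_minimalPrimes_relIdeal
        (fun P hP => isMaximal_of_natCast_mem p L P) (padicInt_natCast_ne_zero p L)
        (padicInt_natCast_not_isUnit p L) (by omega) hQ
      refine ⟨P, hP, hQP, ?_, hp⟩
      rintro _ ⟨k, i, j, rfl⟩
      exact hX k i j)
    (genericFiberRing p (RingOfIntegers p L) q m n) h𝔮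
  exact ⟨𝔓, h𝔓, hle, fun k i j => hmem _ ⟨k, i, j, rfl⟩⟩
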